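/- Perfect-matching solution for the closure (Theorem thm:mainclosure): Let p = (i₀,j₀,k₀) with i₀+j₀+k₀ odd and k an admissible stepped surface with k₀ ≥ k(i₀,j₀) and k ≥ fund. Then T(i₀,j₀,k₀) = Σ_{M̄ ∈ M̄set} w_p(M̄)·w_f(M̄), where M̄set = { M ∪ Diag(E(Ḡ)\E(G)) : M a perfect matching of G }, Diag(A) denotes the set of diagonal edges in A, and Ḡ is the closure of G = G_{p,k}. -/

import Mathlib

noncomputable section
open Classical

namespace OctahedronTSystem

/-- A stepped surface: a height function on `ℤ × ℤ` changing by exactly `1`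
between lattice-adjacent points. -/
def SteppedSurface (k : ℤ × ℤ → ℤ) : Prop :=
  ∀ a b : ℤ × ℤ, |a.1 - b.1| + |a.2 - b.2| = 1 → |k a - k b| = 1

/-- The fundamental stepped surface `fund(i,j) = ((i+j) mod 2) - 1`. -/
def fund : ℤ × ℤ → ℤ := fun v => (v.1 + v.2) % 2 - 1

/-- Index type for the independent variables: `t(i,j)` on the left, `c(i,j)` on the right. -/
abbrev Var : Type := (ℤ × ℤ) ⊕ (ℤ × ℤ)

/-- The ambient field of rational functions over `ℚ` in the independent variables
`t(i,j)` and `c(i,j)`, `(i,j) ∈ ℤ × ℤ`. -/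
abbrev F : Type := FractionRing (MvPolynomial Var ℚ)

/-- The variable `t(i,j)` as an element of the ambient field. -/
def tv (v : ℤ × ℤ) : F := algebraMap (MvPolynomial Var ℚ) F (MvPolynomial.X (Sum.inl v))

/-- The variable `c(i,j)` as an element of the ambient field. -/
def cv (v : ℤ × ℤ) : F := algebraMap (MvPolynomial Var ℚ) F (MvPolynomial.X (Sum.inr v))

/-- `I(i,j,m) = ∏_{a=m+1}^{-m-1} c(i+a,j)` if `m < 0` and `1` otherwise
(the interval `[m+1, -m-1]` is empty when `m ≥ 0`). -/
def coefI {C : Type*} [CommMonoid C] (c : ℤ × ℤ → C) (i j m : ℤ) : C :=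
  ∏ a ∈ Finset.Icc (m + 1) (-m - 1), c (i + a, j)

/-- `J(i,j,m) = ∏_{a=-m}^{m} c(i,j+a)` if `m ≥ 0` and `1` otherwise
(the interval `[-m, m]` is empty when `m < 0`). -/
def coefJ {C : Type*} [CommMonoid C] (c : ℤ × ℤ → C) (i j m : ℤ) : C :=
  ∏ a ∈ Finset.Icc (-m) m, c (i, j + a)

/-- Edges of the bipartite graph `G_k` (the planar dual of the quiver `Q_k`), indexed by
the arrow of `Q_k` they cross:
* `h i j` : the horizontal edge dual to the vertical lattice edge from `(i,j)` to `(i,j+1)`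
  (the face `(i,j)` lies directly below it, the face `(i,j+1)` directly above it);
* `v i j` : the vertical edge dual to the horizontal lattice edge from `(i,j)` to `(i+1,j)`;
* `d i j` : the diagonal edge inside the unit square with lower-left corner `(i,j)`
  (present exactly when that square carries a diagonal arrow). -/
inductive Edge : Type
  | h : ℤ → ℤ → Edge
  | v : ℤ → ℤ → Edge
  | d : ℤ → ℤ → Edge
  deriving DecidableEq

/-- A vertex of `G_k`: a (square or triangular) face of the quiver `Q_k`, recorded as the
unit square (lower-left corner) containing it together with a Boolean: `false` for the
part containing the bottom side of the square, `true` for the part containing the top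
side (used only when the square is split by a diagonal). -/
abbrev Vtx : Type := (ℤ × ℤ) × Bool

namespace Edge

/-- The part of the square `s` touching its west side. -/
def tAD (k : ℤ × ℤ → ℤ) (s : ℤ × ℤ) : Bool := decide (k (s.1 + 1, s.2) ≠ k (s.1, s.2 + 1))

/-- The part of the square `s` touching its east side. -/
def tBC (k : ℤ × ℤ → ℤ) (s : ℤ × ℤ) : Bool := decide (k s ≠ k (s.1 + 1, s.2 + 1))

/-- Endpoints of an edge: `(left, right)` for horizontal and diagonal edges,
`(bottom, top)` for vertical ones. -/
def ends (k : ℤ × ℤ → ℤ) : Edge → Vtx × Vtx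
  | h i j => (((i - 1, j), tBC k (i - 1, j)), ((i, j), tAD k (i, j)))
  | v i j => (((i, j - 1), tAD k (i, j - 1) || tBC k (i, j - 1)), ((i, j), false))
  | d i j => (((i, j), tAD k (i, j)), ((i, j), tBC k (i, j)))

/-- `x` is an endpoint of the edge `e`. -/
def mem (k : ℤ × ℤ → ℤ) (x : Vtx) (e : Edge) : Prop :=
  x = (ends k e).1 ∨ x = (ends k e).2

/-- The edge is present in the graph `G_k` (diagonal edges exist only in squares split
by a diagonal arrow of the quiver). -/
def valid (k : ℤ × ℤ → ℤ) : Edge → Prop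
  | h _ _ => True
  | v _ _ => True
  | d i j => k (i, j) ≠ k (i + 1, j + 1) ∨ k (i + 1, j) ≠ k (i, j + 1)

/-- The edge `e` is a side of the face `f` of `G_k` (faces are indexed by the quiver
vertices `(i,j) ∈ ℤ × ℤ`; an edge is a side of the two faces corresponding to the two
endpoints of the arrow it crosses). -/
def isSide (k : ℤ × ℤ → ℤ) (f : ℤ × ℤ) : Edge → Prop
  | h i j => f = (i, j) ∨ f = (i, j + 1)
  | v i j => f = (i, j) ∨ f = (i + 1, j)
  | d i j => if tAD k (i, j) then f = (i, j) ∨ f = (i + 1, j + 1)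
             else f = (i + 1, j) ∨ f = (i, j + 1)

def isHoriz : Edge → Prop
  | h _ _ => True
  | _ => False

def isVert : Edge → Prop
  | v _ _ => True
  | _ => False

def isDiag : Edge → Prop
  | d _ _ => True
  | _ => False

end Edge

/-- A vertex is white when the arrows around the corresponding face of `Q_k` run
counterclockwise and black when they run clockwise. -/
def isWhite (k : ℤ × ℤ → ℤ) (x : Vtx) : Bool :=
  decide (k (x.1.1 + 1, x.1.2) < k x.1) != x.2

/-- Source of an oriented edge: horizontal and diagonal edges are oriented from left to
right, vertical edges from their black endpoint to their white endpoint. -/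
def Edge.src (k : ℤ × ℤ → ℤ) (e : Edge) : Vtx :=
  match e with
  | Edge.v _ _ =>
      if isWhite k (Edge.ends k e).1 then (Edge.ends k e).2 else (Edge.ends k e).1
  | _ => (Edge.ends k e).1

/-- Target of an oriented edge. -/
def Edge.dst (k : ℤ × ℤ → ℤ) (e : Edge) : Vtx :=
  match e with
  | Edge.v _ _ =>
      if isWhite k (Edge.ends k e).1 then (Edge.ends k e).1 else (Edge.ends k e).2
  | _ => (Edge.ends k e).2

/-- The set `F̊` of closed faces. -/
def innerF (i₀ j₀ k₀ : ℤ) (k : ℤ × ℤ → ℤ) : Set (ℤ × ℤ) :=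
  {f | |f.1 - i₀| + |f.2 - j₀| < k₀ - k f}

/-- The set `∂F` of open faces. -/
def bdryF (i₀ j₀ k₀ : ℤ) (k : ℤ × ℤ → ℤ) : Set (ℤ × ℤ) :=
  if k₀ = k (i₀, j₀) then {(i₀, j₀)}
  else {f | f ∉ innerF i₀ j₀ k₀ k ∧ ∃ g ∈ innerF i₀ j₀ k₀ k, |f.1 - g.1| + |f.2 - g.2| = 1}

/-- The set `F̊ ∪ ∂F` of all faces of the closure. -/
def allF (i₀ j₀ k₀ : ℤ) (k : ℤ × ℤ → ℤ) : Set (ℤ × ℤ) :=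
  innerF i₀ j₀ k₀ k ∪ bdryF i₀ j₀ k₀ k

/-- The edge set of the graph with open faces `G = G_{p,k}`: the finite subgraph of `G_k`
generated by the faces in `F̊`. -/
def EG (i₀ j₀ k₀ : ℤ) (k : ℤ × ℤ → ℤ) : Set Edge :=
  {e | e.valid k ∧ ∃ f ∈ innerF i₀ j₀ k₀ k, e.isSide k f}

/-- The adjusted stepped surface `k_p(i,j) = min (k(i,j), k₀ - |i-i₀| - |j-j₀|)`. -/
def kAdj (i₀ j₀ k₀ : ℤ) (k : ℤ × ℤ → ℤ) : ℤ × ℤ → ℤ :=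
  fun f => min (k f) (k₀ - |f.1 - i₀| - |f.2 - j₀|)

/-- The edge set of the closure `Ḡ` of `G`: the finite subgraph of `G_{k_p}` generated by
the faces in `F̊ ∪ ∂F`. -/
def EGbar (i₀ j₀ k₀ : ℤ) (k : ℤ × ℤ → ℤ) : Set Edge :=
  {e | e.valid (kAdj i₀ j₀ k₀ k) ∧ ∃ f ∈ allF i₀ j₀ k₀ k, e.isSide (kAdj i₀ j₀ k₀ k) f}

/-- The vertex set of the graph with edge set `E`. -/
def VG (k : ℤ × ℤ → ℤ) (E : Set Edge) : Set Vtx := {x | ∃ e ∈ E, Edge.mem k x e}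

/-- A perfect matching of the graph with edge set `E`. -/
def IsPerfectMatching (k : ℤ × ℤ → ℤ) (E M : Set Edge) : Prop :=
  M ⊆ E ∧ ∀ x ∈ VG k E, ∃! e, e ∈ M ∧ Edge.mem k x e

/-- The edge set of the infinite graph `G_∞ = G_{k_p}`. -/
def Einf (i₀ j₀ k₀ : ℤ) (k : ℤ × ℤ → ℤ) : Set Edge := {e | e.valid (kAdj i₀ j₀ k₀ k)}

/-- Acceptable perfect matchings of `G_∞`: perfect matchings `M` of `G_∞` such that
`M \ E(G)` is exactly the set of all diagonal edges of `E(G_∞) \ E(G)`. -/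
def Acceptable (i₀ j₀ k₀ : ℤ) (k : ℤ × ℤ → ℤ) : Set (Set Edge) :=
  {M | IsPerfectMatching (kAdj i₀ j₀ k₀ k) (Einf i₀ j₀ k₀ k) M ∧
       M \ EG i₀ j₀ k₀ k = {e | e ∈ Einf i₀ j₀ k₀ k ∧ e ∉ EG i₀ j₀ k₀ k ∧ e.isDiag}}

/-- The set `Diag(E(Ḡ) \ E(G))` of diagonal edges of the closure not in `G`. -/
def diagExt (i₀ j₀ k₀ : ℤ) (k : ℤ × ℤ → ℤ) : Set Edge :=
  {e | e ∈ EGbar i₀ j₀ k₀ k ∧ e ∉ EG i₀ j₀ k₀ k ∧ e.isDiag}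

/-- `M̄set = { M ∪ Diag(E(Ḡ)\E(G)) : M a perfect matching of G }`. -/
def MbarSet (i₀ j₀ k₀ : ℤ) (k : ℤ × ℤ → ℤ) : Set (Set Edge) :=
  {N | ∃ M, IsPerfectMatching k (EG i₀ j₀ k₀ k) M ∧ N = M ∪ diagExt i₀ j₀ k₀ k}

/-- The set of all white-black horizontal edges (white endpoint on the left) and all
diagonal edges of the graph with edge set `E`; for `E = E(Ḡ)` this is `M̄₀`, for
`E = E(G)` it is `M₀`. -/
def M0 (k : ℤ × ℤ → ℤ) (E : Set Edge) : Set Edge :=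
  {e ∈ E | e.isDiag ∨ (e.isHoriz ∧ isWhite k (Edge.ends k e).1 = true)}

/-- `j ∈ NSet k M i` iff the white-black horizontal edge `N(i,j)` (with face `(i,j)`
directly below it) belongs to `M`. -/
def NSet (k : ℤ × ℤ → ℤ) (M : Set Edge) (i : ℤ) : Set ℤ :=
  {j | Edge.h i j ∈ M ∧ isWhite k (Edge.ends k (Edge.h i j)).1 = true}

/-- `j ∈ SSet k M i` iff the black-white horizontal edge `S(i,j)` (with face `(i,j)`
directly above it) belongs to `M`. -/
def SSet (k : ℤ × ℤ → ℤ) (M : Set Edge) (i : ℤ) : Set ℤ :=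
  {j | Edge.h i (j - 1) ∈ M ∧ isWhite k (Edge.ends k (Edge.h i (j - 1))).1 = false}

/-- A perfect pairing of the horizontal edges of a matching `M`: a set of allowed pairs
`(S(i,j₁), N(i,j₂))`, `j₁ ≤ j₂`, in the same column, using each `S`-edge and each
`N`-edge of `M` exactly once, and noncrossing (this characterises the pairing produced
by the bottom-to-top reading procedure). -/
def IsPerfectPairing (k : ℤ × ℤ → ℤ) (M : Set Edge)
    (P : Set ((ℤ × ℤ) × (ℤ × ℤ))) : Prop :=
  (∀ q ∈ P, q.1.1 = q.2.1 ∧ q.1.2 ≤ q.2.2 ∧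
      q.1.2 ∈ SSet k M q.1.1 ∧ q.2.2 ∈ NSet k M q.2.1) ∧
  (∀ i j : ℤ, j ∈ SSet k M i → ∃! q, q ∈ P ∧ q.1 = (i, j)) ∧
  (∀ i j : ℤ, j ∈ NSet k M i → ∃! q, q ∈ P ∧ q.2 = (i, j)) ∧
  (∀ q ∈ P, ∀ q' ∈ P, q.1.1 = q'.1.1 →
      ¬(q.1.2 < q'.1.2 ∧ q'.1.2 ≤ q.2.2 ∧ q.2.2 < q'.2.2))

/-- The weight `∏_{a=j₁-k(i,j₁)-1}^{j₂+k(i,j₂)+1} c(i,a)` of an allowed pair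
`((i,j₁),(i,j₂))`. -/
def pairWeight (k : ℤ × ℤ → ℤ) (q : (ℤ × ℤ) × (ℤ × ℤ)) : F :=
  ∏ a ∈ Finset.Icc (q.1.2 - k q.1 - 1) (q.2.2 + k q.2 + 1), cv (q.1.1, a)

/-- The pairing-weight: product of the weights of all allowed pairs of a perfect pairing. -/
def wp (k : ℤ × ℤ → ℤ) (P : Set ((ℤ × ℤ) × (ℤ × ℤ))) : F :=
  ∏ᶠ q ∈ P, pairWeight k q

/-- The sides of the face `f` among the edges `E`. -/
def sides (k : ℤ × ℤ → ℤ) (E : Set Edge) (f : ℤ × ℤ) : Set Edge :=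
  {e ∈ E | e.isSide k f}

/-- `⌈(b - a)/2⌉` where `a` (resp. `b`) is the number of sides of the face `f` lying in
(resp. not in) the matching `M`. -/
def faceExp (k : ℤ × ℤ → ℤ) (E M : Set Edge) (f : ℤ × ℤ) : ℤ :=
  ⌈((((sides k E f \ M).ncard : ℚ) - ((sides k E f ∩ M).ncard : ℚ)) / 2 : ℚ)⌉

/-- The face-weight of a matching of the graph with open faces `G`: closed faces
contribute `t(f)^(⌈(b-a)/2⌉ - 1)` and open faces contribute `t(f)^⌈(b-a)/2⌉`. -/
def wfOpen (i₀ j₀ k₀ : ℤ) (k : ℤ × ℤ → ℤ) (E M : Set Edge) : F :=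
  (∏ᶠ f ∈ innerF i₀ j₀ k₀ k, tv f ^ (faceExp k E M f - 1)) *
  (∏ᶠ f ∈ bdryF i₀ j₀ k₀ k, tv f ^ faceExp k E M f)

/-- The face-weight over a set `S` of faces, all of them closed. -/
def wfClosed (k : ℤ × ℤ → ℤ) (E M : Set Edge) (S : Set (ℤ × ℤ)) : F :=
  ∏ᶠ f ∈ S, tv f ^ (faceExp k E M f - 1)

/-- The `c`-exponent function of an edge (an element of the abelian group of `ℤ`-valued
exponent functions on `ℤ × ℤ`):  a white-black horizontal edge `e = h i j` (face
`b = (i,j)` below it) carries `p̄_b = (∏_{α ≥ j + k(i,j) + 2} c(i,α))⁻¹`; a black-white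
horizontal edge `e = h i j` (face `a = (i,j+1)` above it) carries
`p_a = ∏_{α ≥ (j+1) - k(i,j+1) - 1} c(i,α)`; other edges carry no `c`'s.  Colors are read
in the surface `kc`, heights in the surface `kt`. -/
def edgeCExp (kc kt : ℤ × ℤ → ℤ) : Edge → ℤ × ℤ → ℤ
  | Edge.h i j => fun v =>
      if isWhite kc (Edge.ends kc (Edge.h i j)).1 then
        if v.1 = i ∧ j + kt (i, j) + 2 ≤ v.2 then -1 else 0
      else
        if v.1 = i ∧ j - kt (i, j + 1) ≤ v.2 then 1 else 0
  | _ => fun _ => 0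

/-- The `t`-part of the edge-weight: `∏ t(f)⁻¹` over the faces `f ∈ S` incident to `e`. -/
def edgeTPart (k : ℤ × ℤ → ℤ) (S : Set (ℤ × ℤ)) (e : Edge) : F :=
  ∏ᶠ f ∈ {f ∈ S | e.isSide k f}, (tv f)⁻¹

/-- Evaluation of a (finitely supported) exponent function as a Laurent monomial
in the `c(i,j)`. -/
def evalExp (g : ℤ × ℤ → ℤ) : F := ∏ᶠ v : ℤ × ℤ, cv v ^ g v

/-- Left-most vertices lying south-west of the center face `(i₀,j₀)`. -/
def VleftSW (i₀ j₀ : ℤ) (k : ℤ × ℤ → ℤ) (E : Set Edge) : Set Vtx :=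
  {x | x ∈ VG k E ∧ x.1.1 < i₀ ∧ x.1.2 < j₀ ∧
       ¬∃ e ∈ E, (e.isHoriz ∨ e.isDiag) ∧ (Edge.ends k e).2 = x}

/-- Right-most vertices lying south-east of the center face `(i₀,j₀)`. -/
def VrightSE (i₀ j₀ : ℤ) (k : ℤ × ℤ → ℤ) (E : Set Edge) : Set Vtx :=
  {x | x ∈ VG k E ∧ i₀ ≤ x.1.1 ∧ x.1.2 < j₀ ∧
       ¬∃ e ∈ E, (e.isHoriz ∨ e.isDiag) ∧ (Edge.ends k e).1 = x}

/-- Left-most vertices lying north-west of the center face `(i₀,j₀)`. -/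
def VleftNW (i₀ j₀ : ℤ) (k : ℤ × ℤ → ℤ) (E : Set Edge) : Set Vtx :=
  {x | x ∈ VG k E ∧ x.1.1 < i₀ ∧ j₀ ≤ x.1.2 ∧
       ¬∃ e ∈ E, (e.isHoriz ∨ e.isDiag) ∧ (Edge.ends k e).2 = x}

/-- Right-most vertices lying north-east of the center face `(i₀,j₀)`. -/
def VrightNE (i₀ j₀ : ℤ) (k : ℤ × ℤ → ℤ) (E : Set Edge) : Set Vtx :=
  {x | x ∈ VG k E ∧ i₀ ≤ x.1.1 ∧ j₀ ≤ x.1.2 ∧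
       ¬∃ e ∈ E, (e.isHoriz ∨ e.isDiag) ∧ (Edge.ends k e).1 = x}

/-- `P` is the edge set of a family of vertex-disjoint directed paths in the oriented
graph with edge set `E` whose sources are exactly `Src` and whose sinks are exactly
`Snk`. -/
def IsPathFamily (k : ℤ × ℤ → ℤ) (E P : Set Edge) (Src Snk : Set Vtx) : Prop :=
  P ⊆ E ∧
  (∀ x ∈ Src, ({e ∈ P | Edge.src k e = x}).ncard = 1 ∧ {e ∈ P | Edge.dst k e = x} = ∅) ∧
  (∀ x ∈ Snk, ({e ∈ P | Edge.dst k e = x}).ncard = 1 ∧ {e ∈ P | Edge.src k e = x} = ∅) ∧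
  (∀ x : Vtx, x ∉ Src → x ∉ Snk →
      ({e ∈ P | Edge.src k e = x}).ncard = ({e ∈ P | Edge.dst k e = x}).ncard ∧
      ({e ∈ P | Edge.src k e = x}).ncard ≤ 1) ∧
  ∀ x : Vtx, ¬ Relation.TransGen (fun a b => ∃ e ∈ P, Edge.src k e = a ∧ Edge.dst k e = b) x x

/-! ### The local model -/

def ind (X : Finset Edge) (e : Edge) : ℤ := if e ∈ X then 1 else 0

/-- local matching condition at a unit square, in terms of the sides only -/
def sq (κ : ℤ × ℤ → ℤ) (x : Edge → ℤ) (i j : ℤ) : Prop :=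
  if κ (i, j) ≠ κ (i + 1, j + 1) then
    x (Edge.h i j) + x (Edge.v i j) = x (Edge.h (i + 1) j) + x (Edge.v i (j + 1)) ∧
      x (Edge.h i j) + x (Edge.v i j) ≤ 1
  else if κ (i + 1, j) ≠ κ (i, j + 1) then
    x (Edge.v i j) + x (Edge.h (i + 1) j) = x (Edge.h i j) + x (Edge.v i (j + 1)) ∧
      x (Edge.v i j) + x (Edge.h (i + 1) j) ≤ 1
  else x (Edge.h i j) + x (Edge.v i j) + x (Edge.h (i + 1) j) + x (Edge.v i (j + 1)) = 1

def qAC (κ : ℤ × ℤ → ℤ) (x : Edge → ℤ) (i j : ℤ) : ℤ :=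
  if κ (i + 1, j) ≠ κ (i, j + 1) then 2 * (x (Edge.v i j) + x (Edge.h (i + 1) j)) - 1 else 0

def qBD (κ : ℤ × ℤ → ℤ) (x : Edge → ℤ) (i j : ℤ) : ℤ :=
  if κ (i, j) ≠ κ (i + 1, j + 1) then 2 * (x (Edge.h i j) + x (Edge.v i j)) - 1 else 0

def num (κ : ℤ × ℤ → ℤ) (x : Edge → ℤ) (i j : ℤ) : ℤ :=
  2 + qAC κ x i j + qBD κ x (i - 1) j + qAC κ x (i - 1) (j - 1) + qBD κ x i (j - 1)
    - 2 * (x (Edge.h i j) + x (Edge.h i (j - 1)) + x (Edge.v i j) + x (Edge.v (i - 1) j))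

def ex (κ : ℤ × ℤ → ℤ) (x : Edge → ℤ) (f : ℤ × ℤ) : ℤ := (num κ x f.1 f.2 + 1) / 2

def om {K : Type*} [Field K] (C : ℤ → ℤ → K) (κ : ℤ × ℤ → ℤ) : Edge → K
  | Edge.h i j => if κ (i, j) < κ (i, j + 1) then C i (j + κ (i, j) + 2)
      else (C i (j - κ (i, j + 1)))⁻¹
  | _ => 1

def isE (cone κ : ℤ × ℤ → ℤ) : Edge → Prop
  | Edge.h i j => κ (i, j) < cone (i, j) ∨ κ (i, j + 1) < cone (i, j + 1)
  | Edge.v i j => κ (i, j) < cone (i, j) ∨ κ (i + 1, j) < cone (i + 1, j)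
  | Edge.d _ _ => False

def Val (cone κ : ℤ × ℤ → ℤ) (X : Finset Edge) : Prop :=
  (∀ a b, sq κ (ind X) a b) ∧ ∀ e ∈ X, isE cone κ e

def wt {K : Type*} [Field K] (C : ℤ → ℤ → K) (κ : ℤ × ℤ → ℤ) (τ : ℤ × ℤ → K)
    (A : Finset (ℤ × ℤ)) (X : Finset Edge) : K :=
  (∏ f ∈ A, τ f ^ ex κ (ind X) f) * ∏ e ∈ X, om C κ e

def Zf {K : Type*} [Field K] (C : ℤ → ℤ → K) (cone κ : ℤ × ℤ → ℤ) (τ : ℤ × ℤ → K)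
    (A : Finset (ℤ × ℤ)) (E : Finset Edge) : K :=
  ∑ X ∈ E.powerset, if Val cone κ X then wt C κ τ A X else 0

/-- the set `Y` with some of the four sides of the face `(i,j)` added -/
def Xz (Y : Finset Edge) (i j : ℤ) (n s e w : Bool) : Finset Edge :=
  ((Y ∪ if n then {Edge.h i j} else ∅) ∪ if s then {Edge.h i (j - 1)} else ∅) ∪
    (if e then {Edge.v i j} else ∅) ∪ if w then {Edge.v (i - 1) j} else ∅

def bz (b : Bool) : ℤ := if b then 1 else 0

def isF (i j : ℤ) (e : Edge) : Prop :=
  e = Edge.h i j ∨ e = Edge.h i (j - 1) ∨ e = Edge.v i j ∨ e = Edge.v (i - 1) j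

/-- `x` is obtained from `y` by setting the four sides of `(i,j)` -/
structure Ext (i j : ℤ) (y x : Edge → ℤ) (n s e w : ℤ) : Prop where
  hn : x (Edge.h i j) = n
  hs : x (Edge.h i (j - 1)) = s
  he : x (Edge.v i j) = e
  hw : x (Edge.v (i - 1) j) = w
  ho : ∀ g, ¬ isF i j g → x g = y g

lemma ext_Xz (Y : Finset Edge) (i j : ℤ) (hY : ∀ e ∈ Y, ¬ isF i j e) (n s e w : Bool) :
    Ext i j (ind Y) (ind (Xz Y i j n s e w)) (bz n) (bz s) (bz e) (bz w) := by
  have h1 : Edge.h i j ∉ Y := fun h => hY _ h (by simp [isF])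
  have h2 : Edge.h i (j-1) ∉ Y := fun h => hY _ h (by simp [isF])
  have h3 : Edge.v i j ∉ Y := fun h => hY _ h (by simp [isF])
  have h4 : Edge.v (i-1) j ∉ Y := fun h => hY _ h (by simp [isF])
  refine ⟨?_, ?_, ?_, ?_, ?_⟩
  · cases n <;> cases s <;> cases e <;> cases w <;> simp [ind, Xz, bz, h1, show ¬ j = j - 1 by omega]
  · cases n <;> cases s <;> cases e <;> cases w <;> simp [ind, Xz, bz, h2]
  · cases n <;> cases s <;> cases e <;> cases w <;> simp [ind, Xz, bz, h3, show ¬ i = i - 1 by omega]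
  · cases n <;> cases s <;> cases e <;> cases w <;> simp [ind, Xz, bz, h4]
  · intro g hg
    simp only [isF, not_or] at hg
    obtain ⟨g1, g2, g3, g4⟩ := hg
    have : g ∈ Xz Y i j n s e w ↔ g ∈ Y := by
      cases n <;> cases s <;> cases e <;> cases w <;> simp [Xz, g1, g2, g3, g4]
    simp [ind, this]

/-- local minimum flip data -/
structure Flip (κ κ' : ℤ × ℤ → ℤ) (i j m : ℤ) : Prop where
  c0 : κ (i, j) = m - 1
  c1 : κ' (i, j) = m + 1
  n : κ (i, j + 1) = m
  s : κ (i, j - 1) = m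
  e : κ (i + 1, j) = m
  w : κ (i - 1, j) = m
  ne : κ (i + 1, j + 1) = m - 1 ∨ κ (i + 1, j + 1) = m + 1
  nw : κ (i - 1, j + 1) = m - 1 ∨ κ (i - 1, j + 1) = m + 1
  sw : κ (i - 1, j - 1) = m - 1 ∨ κ (i - 1, j - 1) = m + 1
  se : κ (i + 1, j - 1) = m - 1 ∨ κ (i + 1, j - 1) = m + 1
  o : ∀ g, g ≠ (i, j) → κ' g = κ g

lemma Flip.facts {κ κ' : ℤ × ℤ → ℤ} {i j m : ℤ} (H : Flip κ κ' i j m) :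
    κ' (i, j + 1) = m ∧ κ' (i, j - 1) = m ∧ κ' (i + 1, j) = m ∧ κ' (i - 1, j) = m ∧
    κ' (i + 1, j + 1) = κ (i + 1, j + 1) ∧ κ' (i - 1, j + 1) = κ (i - 1, j + 1) ∧
    κ' (i - 1, j - 1) = κ (i - 1, j - 1) ∧ κ' (i + 1, j - 1) = κ (i + 1, j - 1) := by
  refine ⟨?_, ?_, ?_, ?_, ?_, ?_, ?_, ?_⟩ <;> rw [H.o _ (by simp)]
  exacts [H.n, H.s, H.e, H.w]

/-- requirement at a corner: `B u` the condition before, `A u` after. -/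
def Cor (B A : ℤ → Prop) : Prop :=
  (∀ u, 0 ≤ u → u ≤ 2 → ¬ B u ∧ ¬ A u) ∨ ∃ r, (r = 0 ∨ r = 1) ∧
    ∀ u, 0 ≤ u → u ≤ 2 → (B u ↔ u = r) ∧ (A u ↔ u = 1 - r)

lemma cor_basic (p : Prop) (r : ℤ) (hr : 0 ≤ r) (B A : ℤ → Prop)
    (h : (p ∧ (∀ u, B u ↔ u + r = 1) ∧ (∀ u, A u ↔ u = r ∧ u ≤ 1)) ∨
      (¬ p ∧ (∀ u, A u ↔ u + r = 1) ∧ (∀ u, B u ↔ u = r ∧ u ≤ 1))) : Cor B A := by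
  by_cases h2 : r ≤ 1
  · right
    rcases h with ⟨_, hB, hA⟩ | ⟨_, hA, hB⟩
    · exact ⟨1 - r, by omega, fun u _ _ => ⟨by rw [hB]; omega, by rw [hA]; omega⟩⟩
    · exact ⟨r, by omega, fun u _ _ => ⟨by rw [hB]; omega, by rw [hA]; omega⟩⟩
  · left
    rcases h with ⟨_, hB, hA⟩ | ⟨_, hA, hB⟩
    · exact fun u _ _ => ⟨by rw [hB]; omega, by rw [hA]; omega⟩
    · exact fun u _ _ => ⟨by rw [hB]; omega, by rw [hA]; omega⟩

set_option linter.unusedSimpArgs false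
set_option linter.unusedVariables false
set_option linter.unusedTactic false
set_option linter.unreachableTactic false

/-! ### Corners of a flipped face -/

lemma corNE {κ κ' : ℤ × ℤ → ℤ} {i j m : ℤ} (H : Flip κ κ' i j m) (y : Edge → ℤ)
    (hy : ∀ g, 0 ≤ y g) : ∃ B A, Cor B A ∧ ∀ x n s e w, Ext i j y x n s e w →
      (sq κ x i j ↔ B (n + e)) ∧ (sq κ' x i j ↔ A (n + e)) := by
  obtain ⟨h1, h2, h3, h4, h5, h6, h7, h8⟩ := H.facts
  have p1 := hy (Edge.h (i + 1) j)
  have p2 := hy (Edge.v i (j + 1))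
  have hc := H.ne
  refine ⟨fun u => if κ (i + 1, j + 1) = m - 1 then u + (y (Edge.h (i + 1) j) + y (Edge.v i (j + 1))) = 1
    else u = y (Edge.h (i + 1) j) + y (Edge.v i (j + 1)) ∧ u ≤ 1,
    fun u => if ¬ κ (i + 1, j + 1) = m - 1 then u + (y (Edge.h (i + 1) j) + y (Edge.v i (j + 1))) = 1
    else u = y (Edge.h (i + 1) j) + y (Edge.v i (j + 1)) ∧ u ≤ 1,
    cor_basic (κ (i + 1, j + 1) = m - 1) _ (add_nonneg p1 p2) _ _ ?_, ?_⟩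
  · by_cases hp : κ (i + 1, j + 1) = m - 1 <;> simp [hp]
  · intro x n s e w hx
    have e1 := hx.ho (Edge.h (i + 1) j) (by simp [isF])
    have e2 := hx.ho (Edge.v i (j + 1)) (by simp [isF]; try omega)
    simp only [sq, H.c0, H.c1, H.e, H.n, h1, h3, h5, e1, e2, hx.hn, hx.he]
    split_ifs <;> constructor <;> omega

lemma corSW {κ κ' : ℤ × ℤ → ℤ} {i j m : ℤ} (H : Flip κ κ' i j m) (y : Edge → ℤ)
    (hy : ∀ g, 0 ≤ y g) : ∃ B A, Cor B A ∧ ∀ x n s e w, Ext i j y x n s e w →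
      (sq κ x (i - 1) (j - 1) ↔ B (s + w)) ∧ (sq κ' x (i - 1) (j - 1) ↔ A (s + w)) := by
  obtain ⟨h1, h2, h3, h4, h5, h6, h7, h8⟩ := H.facts
  have p1 := hy (Edge.h (i - 1) (j - 1))
  have p2 := hy (Edge.v (i - 1) (j - 1))
  have hc := H.sw
  refine ⟨fun u => if κ (i - 1, j - 1) = m - 1 then u + (y (Edge.h (i - 1) (j - 1)) + y (Edge.v (i - 1) (j - 1))) = 1
    else u = y (Edge.h (i - 1) (j - 1)) + y (Edge.v (i - 1) (j - 1)) ∧ u ≤ 1,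
    fun u => if ¬ κ (i - 1, j - 1) = m - 1 then u + (y (Edge.h (i - 1) (j - 1)) + y (Edge.v (i - 1) (j - 1))) = 1
    else u = y (Edge.h (i - 1) (j - 1)) + y (Edge.v (i - 1) (j - 1)) ∧ u ≤ 1,
    cor_basic (κ (i - 1, j - 1) = m - 1) _ (add_nonneg p1 p2) _ _ ?_, ?_⟩
  · by_cases hp : κ (i - 1, j - 1) = m - 1 <;> simp [hp]
  · intro x n s e w hx
    have e1 := hx.ho (Edge.h (i - 1) (j - 1)) (by simp [isF])
    have e2 := hx.ho (Edge.v (i - 1) (j - 1)) (by simp [isF])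
    simp only [sq, sub_add_cancel, H.c0, H.c1, H.s, H.w, h2, h4, h7, e1, e2, hx.hs, hx.hw]
    split_ifs <;> constructor <;> omega

lemma corNW {κ κ' : ℤ × ℤ → ℤ} {i j m : ℤ} (H : Flip κ κ' i j m) (y : Edge → ℤ)
    (hy : ∀ g, 0 ≤ y g) : ∃ B A, Cor B A ∧ ∀ x n s e w, Ext i j y x n s e w →
      (sq κ x (i - 1) j ↔ B (n + w)) ∧ (sq κ' x (i - 1) j ↔ A (n + w)) := by
  obtain ⟨h1, h2, h3, h4, h5, h6, h7, h8⟩ := H.facts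
  have p1 := hy (Edge.h (i - 1) j)
  have p2 := hy (Edge.v (i - 1) (j + 1))
  have hc := H.nw
  refine ⟨fun u => if κ (i - 1, j + 1) = m - 1 then u + (y (Edge.h (i - 1) j) + y (Edge.v (i - 1) (j + 1))) = 1
    else u = y (Edge.h (i - 1) j) + y (Edge.v (i - 1) (j + 1)) ∧ u ≤ 1,
    fun u => if ¬ κ (i - 1, j + 1) = m - 1 then u + (y (Edge.h (i - 1) j) + y (Edge.v (i - 1) (j + 1))) = 1
    else u = y (Edge.h (i - 1) j) + y (Edge.v (i - 1) (j + 1)) ∧ u ≤ 1,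
    cor_basic (κ (i - 1, j + 1) = m - 1) _ (add_nonneg p1 p2) _ _ ?_, ?_⟩
  · by_cases hp : κ (i - 1, j + 1) = m - 1 <;> simp [hp]
  · intro x n s e w hx
    have e1 := hx.ho (Edge.h (i - 1) j) (by simp [isF])
    have e2 := hx.ho (Edge.v (i - 1) (j + 1)) (by simp [isF])
    simp only [sq, sub_add_cancel, H.c0, H.c1, H.n, H.w, h1, h4, h6, e1, e2, hx.hn, hx.hw]
    split_ifs <;> constructor <;> omega

lemma corSE {κ κ' : ℤ × ℤ → ℤ} {i j m : ℤ} (H : Flip κ κ' i j m) (y : Edge → ℤ)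
    (hy : ∀ g, 0 ≤ y g) : ∃ B A, Cor B A ∧ ∀ x n s e w, Ext i j y x n s e w →
      (sq κ x i (j - 1) ↔ B (s + e)) ∧ (sq κ' x i (j - 1) ↔ A (s + e)) := by
  obtain ⟨h1, h2, h3, h4, h5, h6, h7, h8⟩ := H.facts
  have p1 := hy (Edge.h (i + 1) (j - 1))
  have p2 := hy (Edge.v i (j - 1))
  have hc := H.se
  refine ⟨fun u => if κ (i + 1, j - 1) = m - 1 then u + (y (Edge.h (i + 1) (j - 1)) + y (Edge.v i (j - 1))) = 1
    else u = y (Edge.h (i + 1) (j - 1)) + y (Edge.v i (j - 1)) ∧ u ≤ 1,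
    fun u => if ¬ κ (i + 1, j - 1) = m - 1 then u + (y (Edge.h (i + 1) (j - 1)) + y (Edge.v i (j - 1))) = 1
    else u = y (Edge.h (i + 1) (j - 1)) + y (Edge.v i (j - 1)) ∧ u ≤ 1,
    cor_basic (κ (i + 1, j - 1) = m - 1) _ (add_nonneg p1 p2) _ _ ?_, ?_⟩
  · by_cases hp : κ (i + 1, j - 1) = m - 1 <;> simp [hp]
  · intro x n s e w hx
    have e1 := hx.ho (Edge.h (i + 1) (j - 1)) (by simp [isF])
    have e2 := hx.ho (Edge.v i (j - 1)) (by simp [isF]; try omega)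
    simp only [sq, sub_add_cancel, H.c0, H.c1, H.s, H.e, h2, h3, h8, e1, e2, hx.hs, hx.he]
    split_ifs <;> constructor <;> omega

/-! ### Face exponents under a flip -/

lemma num_center {κ : ℤ × ℤ → ℤ} {i j m : ℤ} (hn : κ (i, j + 1) = m) (hs : κ (i, j - 1) = m)
    (he : κ (i + 1, j) = m) (hw : κ (i - 1, j) = m) {y x : Edge → ℤ} {n s e w : ℤ}
    (hx : Ext i j y x n s e w) : ex κ x (i, j) = 1 - (n + s + e + w) := by
  simp only [ex, num, qAC, qBD, sub_add_cancel, hn, hs, he, hw, hx.hn, hx.hs, hx.he, hx.hw]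
  simp
  omega

lemma key_half (a b c : ℤ) (h : b = a + 2 * c) : (b + 1) / 2 = (a + 1) / 2 + c := by omega

lemma ex_N {κ κ' : ℤ × ℤ → ℤ} {i j m : ℤ} (H : Flip κ κ' i j m) {y x x' : Edge → ℤ}
    {n s e w n' s' e' w' : ℤ} (hx : Ext i j y x n s e w) (hx' : Ext i j y x' n' s' e' w')
    (v1 : sq κ x i j) (v2 : sq κ x (i - 1) j) (v1' : sq κ' x' i j) (v2' : sq κ' x' (i - 1) j)
    (k1 : n + e + (n' + e') = 1) (k2 : n + w + (n' + w') = 1) :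
    ex κ' x' (i, j + 1) = ex κ x (i, j + 1) + (1 - n - e - w - n') := by
  obtain ⟨h1, h2, h3, h4, h5, h6, h7, h8⟩ := H.facts
  have hc1 := H.ne
  have hc2 := H.nw
  have hc3 := H.sw
  have hc4 := H.se
  have hg : ∀ g, ¬ isF i j g → x' g = x g := fun g h => by rw [hx.ho g h, hx'.ho g h]
  have e0 := hg (Edge.h (i + 1) j) (by simp [isF] <;> omega)
  have e1 := hg (Edge.v i (j + 1)) (by simp [isF] <;> omega)
  have e2 := hg (Edge.h (i - 1) j) (by simp [isF] <;> omega)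
  have e3 := hg (Edge.v (i - 1) (j + 1)) (by simp [isF] <;> omega)
  have e4 := hg (Edge.h i (j + 1)) (by simp [isF] <;> omega)
  have e5 := hg (Edge.h (i + 1) (j + 1)) (by simp [isF] <;> omega)
  have e6 := hg (Edge.h (i - 1) (j + 1)) (by simp [isF] <;> omega)
  have o1 := H.o (i, j + 1 + 1) (by simp <;> omega)
  simp only [sq, sub_add_cancel, H.c0, H.c1, H.n, H.s, H.w, H.e, h1, h2, h3, h4, h5, h6, h7, h8, e0, e1, e2, e3, e4, e5, e6,
    hx.hn, hx.hs, hx.hw, hx.he, hx'.hn, hx'.hs, hx'.hw, hx'.he] at v1 v2 v1' v2'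
  simp only [ex, num, qAC, qBD, sub_add_cancel, add_sub_cancel_right, H.c0, H.c1, h5, h6, h7, h8,
    e0, e1, e2, e3, e4, e5, e6, o1, hx.hn, hx.hs, hx.hw, hx.he, hx'.hn, hx'.hs, hx'.hw, hx'.he]
  apply key_half
  generalize (if κ (i + 1, j + 1) ≠ κ (i, j + 1 + 1) then _ else 0 : ℤ) = a0
  generalize (if κ (i - 1, j + 1) ≠ κ (i, j + 1 + 1) then _ else 0 : ℤ) = a1
  split_ifs at v1 v2 v1' v2' ⊢ <;> omega

lemma ex_S {κ κ' : ℤ × ℤ → ℤ} {i j m : ℤ} (H : Flip κ κ' i j m) {y x x' : Edge → ℤ}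
    {n s e w n' s' e' w' : ℤ} (hx : Ext i j y x n s e w) (hx' : Ext i j y x' n' s' e' w')
    (v1 : sq κ x i (j - 1)) (v2 : sq κ x (i - 1) (j - 1)) (v1' : sq κ' x' i (j - 1)) (v2' : sq κ' x' (i - 1) (j - 1))
    (k1 : s + e + (s' + e') = 1) (k2 : s + w + (s' + w') = 1) :
    ex κ' x' (i, j - 1) = ex κ x (i, j - 1) + (1 - s - e - w - s') := by
  obtain ⟨h1, h2, h3, h4, h5, h6, h7, h8⟩ := H.facts
  have hc1 := H.ne
  have hc2 := H.nw
  have hc3 := H.sw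
  have hc4 := H.se
  have hg : ∀ g, ¬ isF i j g → x' g = x g := fun g h => by rw [hx.ho g h, hx'.ho g h]
  have e0 := hg (Edge.h (i + 1) (j - 1)) (by simp [isF] <;> omega)
  have e1 := hg (Edge.v i (j - 1)) (by simp [isF] <;> omega)
  have e2 := hg (Edge.h (i - 1) (j - 1)) (by simp [isF] <;> omega)
  have e3 := hg (Edge.v (i - 1) (j - 1)) (by simp [isF] <;> omega)
  have e4 := hg (Edge.h i (j - 1 - 1)) (by simp [isF] <;> omega)
  have e5 := hg (Edge.v i (j - 1 - 1)) (by simp [isF] <;> omega)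
  have e6 := hg (Edge.v (i - 1) (j - 1 - 1)) (by simp [isF] <;> omega)
  have o1 := H.o (i, j - 1 - 1) (by simp <;> omega)
  simp only [sq, sub_add_cancel, H.c0, H.c1, H.n, H.s, H.w, H.e, h1, h2, h3, h4, h5, h6, h7, h8, e0, e1, e2, e3, e4, e5, e6,
    hx.hn, hx.hs, hx.hw, hx.he, hx'.hn, hx'.hs, hx'.hw, hx'.he] at v1 v2 v1' v2'
  simp only [ex, num, qAC, qBD, sub_add_cancel, add_sub_cancel_right, H.c0, H.c1, h5, h6, h7, h8,
    e0, e1, e2, e3, e4, e5, e6, o1, hx.hn, hx.hs, hx.hw, hx.he, hx'.hn, hx'.hs, hx'.hw, hx'.he]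
  apply key_half
  generalize (if κ (i, j - 1 - 1) ≠ κ (i - 1, j - 1) then _ else 0 : ℤ) = a0
  generalize (if κ (i, j - 1 - 1) ≠ κ (i + 1, j - 1) then _ else 0 : ℤ) = a1
  split_ifs at v1 v2 v1' v2' ⊢ <;> omega

lemma ex_E {κ κ' : ℤ × ℤ → ℤ} {i j m : ℤ} (H : Flip κ κ' i j m) {y x x' : Edge → ℤ}
    {n s e w n' s' e' w' : ℤ} (hx : Ext i j y x n s e w) (hx' : Ext i j y x' n' s' e' w')
    (v1 : sq κ x i j) (v2 : sq κ x i (j - 1)) (v1' : sq κ' x' i j) (v2' : sq κ' x' i (j - 1))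
    (k1 : n + e + (n' + e') = 1) (k2 : s + e + (s' + e') = 1) :
    ex κ' x' (i + 1, j) = ex κ x (i + 1, j) + (1 - n - s - e - e') := by
  obtain ⟨h1, h2, h3, h4, h5, h6, h7, h8⟩ := H.facts
  have hc1 := H.ne
  have hc2 := H.nw
  have hc3 := H.sw
  have hc4 := H.se
  have hg : ∀ g, ¬ isF i j g → x' g = x g := fun g h => by rw [hx.ho g h, hx'.ho g h]
  have e0 := hg (Edge.h (i + 1) j) (by simp [isF] <;> omega)
  have e1 := hg (Edge.v i (j + 1)) (by simp [isF] <;> omega)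
  have e2 := hg (Edge.h (i + 1) (j - 1)) (by simp [isF] <;> omega)
  have e3 := hg (Edge.v i (j - 1)) (by simp [isF] <;> omega)
  have e4 := hg (Edge.v (i + 1) j) (by simp [isF] <;> omega)
  have e5 := hg (Edge.v (i + 1) (j - 1)) (by simp [isF] <;> omega)
  have e6 := hg (Edge.h (i + 1 + 1) j) (by simp [isF] <;> omega)
  have o1 := H.o (i + 1 + 1, j) (by simp <;> omega)
  simp only [sq, sub_add_cancel, H.c0, H.c1, H.n, H.s, H.w, H.e, h1, h2, h3, h4, h5, h6, h7, h8, e0, e1, e2, e3, e4, e5, e6,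
    hx.hn, hx.hs, hx.hw, hx.he, hx'.hn, hx'.hs, hx'.hw, hx'.he] at v1 v2 v1' v2'
  simp only [ex, num, qAC, qBD, sub_add_cancel, add_sub_cancel_right, H.c0, H.c1, h5, h6, h7, h8,
    e0, e1, e2, e3, e4, e5, e6, o1, hx.hn, hx.hs, hx.hw, hx.he, hx'.hn, hx'.hs, hx'.hw, hx'.he]
  apply key_half
  generalize (if κ (i + 1 + 1, j) ≠ κ (i + 1, j + 1) then _ else 0 : ℤ) = a0
  generalize (if κ (i + 1, j - 1) ≠ κ (i + 1 + 1, j) then _ else 0 : ℤ) = a1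
  split_ifs at v1 v2 v1' v2' ⊢ <;> omega

lemma ex_W {κ κ' : ℤ × ℤ → ℤ} {i j m : ℤ} (H : Flip κ κ' i j m) {y x x' : Edge → ℤ}
    {n s e w n' s' e' w' : ℤ} (hx : Ext i j y x n s e w) (hx' : Ext i j y x' n' s' e' w')
    (v1 : sq κ x (i - 1) j) (v2 : sq κ x (i - 1) (j - 1)) (v1' : sq κ' x' (i - 1) j) (v2' : sq κ' x' (i - 1) (j - 1))
    (k1 : n + w + (n' + w') = 1) (k2 : s + w + (s' + w') = 1) :
    ex κ' x' (i - 1, j) = ex κ x (i - 1, j) + (1 - n - s - w - w') := by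
  obtain ⟨h1, h2, h3, h4, h5, h6, h7, h8⟩ := H.facts
  have hc1 := H.ne
  have hc2 := H.nw
  have hc3 := H.sw
  have hc4 := H.se
  have hg : ∀ g, ¬ isF i j g → x' g = x g := fun g h => by rw [hx.ho g h, hx'.ho g h]
  have e0 := hg (Edge.h (i - 1) j) (by simp [isF] <;> omega)
  have e1 := hg (Edge.v (i - 1) (j + 1)) (by simp [isF] <;> omega)
  have e2 := hg (Edge.h (i - 1) (j - 1)) (by simp [isF] <;> omega)
  have e3 := hg (Edge.v (i - 1) (j - 1)) (by simp [isF] <;> omega)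
  have e4 := hg (Edge.v (i - 1 - 1) j) (by simp [isF] <;> omega)
  have e5 := hg (Edge.v (i - 1 - 1) (j - 1)) (by simp [isF] <;> omega)
  have e6 := hg (Edge.h (i - 1 - 1) j) (by simp [isF] <;> omega)
  have o1 := H.o (i - 1 - 1, j) (by simp <;> omega)
  simp only [sq, sub_add_cancel, H.c0, H.c1, H.n, H.s, H.w, H.e, h1, h2, h3, h4, h5, h6, h7, h8, e0, e1, e2, e3, e4, e5, e6,
    hx.hn, hx.hs, hx.hw, hx.he, hx'.hn, hx'.hs, hx'.hw, hx'.he] at v1 v2 v1' v2'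
  simp only [ex, num, qAC, qBD, sub_add_cancel, add_sub_cancel_right, H.c0, H.c1, h5, h6, h7, h8,
    e0, e1, e2, e3, e4, e5, e6, o1, hx.hn, hx.hs, hx.hw, hx.he, hx'.hn, hx'.hs, hx'.hw, hx'.he]
  apply key_half
  generalize (if κ (i - 1 - 1, j) ≠ κ (i - 1, j + 1) then _ else 0 : ℤ) = a0
  generalize (if κ (i - 1, j - 1) ≠ κ (i - 1 - 1, j) then _ else 0 : ℤ) = a1
  split_ifs at v1 v2 v1' v2' ⊢ <;> omega


lemma ex_other {κ κ' : ℤ × ℤ → ℤ} {i j m : ℤ} (H : Flip κ κ' i j m) {y x x' : Edge → ℤ}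
    {n s e w n' s' e' w' : ℤ} (hx : Ext i j y x n s e w) (hx' : Ext i j y x' n' s' e' w')
    (a b : ℤ) (g0 : ¬ (a = i ∧ b = j)) (g1 : ¬ (a = i ∧ b = j + 1)) (g2 : ¬ (a = i ∧ b = j - 1))
    (g3 : ¬ (a = i + 1 ∧ b = j)) (g4 : ¬ (a = i - 1 ∧ b = j)) :
    ex κ' x' (a, b) = ex κ x (a, b) := by
  obtain ⟨h1, h2, h3, h4, h5, h6, h7, h8⟩ := H.facts
  have X : ∀ g, ¬ isF i j g → x' g = x g := fun g hg => by rw [hx.ho g hg, hx'.ho g hg]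
  have q1 : qAC κ' x' a b = qAC κ x a b := by
    unfold qAC
    by_cases hc : a = i - 1 ∧ b = j - 1
    · obtain ⟨rfl, rfl⟩ := hc
      simp only [sub_add_cancel, h2, h4, H.s, H.w]; simp
    · rw [X (Edge.v a b) (by simp [isF]; omega), X (Edge.h (a+1) b) (by simp [isF]; omega),
        H.o (a+1, b) (by simp; omega), H.o (a, b+1) (by simp; omega)]
  have q2 : qBD κ' x' (a-1) b = qBD κ x (a-1) b := by
    unfold qBD
    by_cases hc : a = i + 1 ∧ b = j - 1
    · obtain ⟨rfl, rfl⟩ := hc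
      simp only [sub_add_cancel, add_sub_cancel_right, h2, h3, H.s, H.e]; simp
    · rw [X (Edge.v (a-1) b) (by simp [isF]; omega), X (Edge.h (a-1) b) (by simp [isF]; omega),
        H.o (a-1, b) (by simp; omega), H.o (a-1+1, b+1) (by simp; omega)]
  have q3 : qAC κ' x' (a-1) (b-1) = qAC κ x (a-1) (b-1) := by
    unfold qAC
    by_cases hc : a = i + 1 ∧ b = j + 1
    · obtain ⟨rfl, rfl⟩ := hc
      simp only [sub_add_cancel, add_sub_cancel_right, h1, h3, H.n, H.e]; simp
    · rw [X (Edge.v (a-1) (b-1)) (by simp [isF]; omega), X (Edge.h (a-1+1) (b-1)) (by simp [isF]; omega),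
        H.o (a-1+1, b-1) (by simp; omega), H.o (a-1, b-1+1) (by simp; omega)]
  have q4 : qBD κ' x' a (b-1) = qBD κ x a (b-1) := by
    unfold qBD
    by_cases hc : a = i - 1 ∧ b = j + 1
    · obtain ⟨rfl, rfl⟩ := hc
      simp only [sub_add_cancel, add_sub_cancel_right, h1, h4, H.n, H.w]; simp
    · rw [X (Edge.v a (b-1)) (by simp [isF]; omega), X (Edge.h a (b-1)) (by simp [isF]; omega),
        H.o (a, b-1) (by simp; omega), H.o (a+1, b-1+1) (by simp; omega)]
  simp only [ex, num]
  rw [q1, q2, q3, q4, X (Edge.h a b) (by simp [isF]; omega), X (Edge.h a (b-1)) (by simp [isF]; omega),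
    X (Edge.v a b) (by simp [isF]; omega), X (Edge.v (a-1) b) (by simp [isF]; omega)]

section
variable {K : Type*} [Field K] (C : ℤ → ℤ → K)

lemma om_other {κ κ' : ℤ × ℤ → ℤ} {i j m : ℤ} (H : Flip κ κ' i j m) (e : Edge) (he : ¬ isF i j e) :
    om C κ' e = om C κ e := by
  rcases e with ⟨a, b⟩ | ⟨a, b⟩ | ⟨a, b⟩
  · simp [isF] at he
    simp only [om]
    rw [H.o (a, b) (by simp; omega), H.o (a, b+1) (by simp; omega)]
  · rfl
  · rfl

lemma om_vals {κ κ' : ℤ × ℤ → ℤ} {i j m : ℤ} (H : Flip κ κ' i j m) :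
    om C κ (Edge.h i j) = C i (j + m + 1) ∧ om C κ (Edge.h i (j-1)) = (C i (j - m))⁻¹ ∧
    om C κ' (Edge.h i j) = (C i (j - m))⁻¹ ∧ om C κ' (Edge.h i (j-1)) = C i (j + m + 1) := by
  obtain ⟨h1, h2, h3, h4, h5, h6, h7, h8⟩ := H.facts
  refine ⟨?_, ?_, ?_, ?_⟩
  · simp only [om, H.c0, H.n]; rw [if_pos (by omega)]; congr 1; ring
  · simp only [om, sub_add_cancel, H.c0, H.s]; rw [if_neg (by omega)]; congr 2; ring
  · simp only [om, H.c1, h1]; rw [if_neg (by omega)]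
  · simp only [om, sub_add_cancel, H.c1, h2]; rw [if_pos (by omega)]; congr 1; ring

lemma prod_om_Xz (κ : ℤ × ℤ → ℤ) (Y : Finset Edge) (i j : ℤ) (hY : ∀ e ∈ Y, ¬ isF i j e)
    (n s e w : Bool) : ∏ g ∈ Xz Y i j n s e w, om C κ g =
      (∏ g ∈ Y, om C κ g) * (om C κ (Edge.h i j) ^ (bz n) * om C κ (Edge.h i (j-1)) ^ (bz s)) := by
  have h1 : Edge.h i j ∉ Y := fun h => hY _ h (by simp [isF])
  have h2 : Edge.h i (j-1) ∉ Y := fun h => hY _ h (by simp [isF])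
  have h3 : Edge.v i j ∉ Y := fun h => hY _ h (by simp [isF])
  have h4 : Edge.v (i-1) j ∉ Y := fun h => hY _ h (by simp [isF])
  have o1 : om C κ (Edge.v i j) = 1 := rfl
  have o2 : om C κ (Edge.v (i-1) j) = 1 := rfl
  rw [Xz, Finset.prod_union, Finset.prod_union, Finset.prod_union, Finset.prod_union]
  · cases n <;> cases s <;> cases e <;> cases w <;> simp [bz, o1, o2, mul_assoc]
  · cases n <;> simp [h1]
  · cases n <;> cases s <;> simp [h2]
  · cases n <;> cases s <;> cases e <;> simp [h3]
  · cases n <;> cases s <;> cases e <;> cases w <;> simp [h4]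

lemma sum16 {K : Type*} [Field K] (r1 r2 r3 r4 : ℤ) (h1 : r1 = 0 ∨ r1 = 1) (h2 : r2 = 0 ∨ r2 = 1)
    (h3 : r3 = 0 ∨ r3 = 1) (h4 : r4 = 0 ∨ r4 = 1) (W W' : Bool → Bool → Bool → Bool → K)
    (f f' N S E V P Q : K) (hf : f ≠ 0) (hf' : f' ≠ 0) (hN : N ≠ 0) (hS : S ≠ 0) (hE : E ≠ 0)
    (hV : V ≠ 0) (hP : P ≠ 0) (hQ : Q ≠ 0) (hrec : f * f' = P * Q * V * E + S * N)
    (hr : ∀ n s e w n' s' e' w' : Bool, 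
      bz n + bz e = r1 → bz s + bz w = r2 → bz n + bz w = r3 → bz s + bz e = r4 →
      bz n' + bz e' = 1 - r1 → bz s' + bz w' = 1 - r2 → bz n' + bz w' = 1 - r3 →
      bz s' + bz e' = 1 - r4 →
      W' n' s' e' w' * (f ^ (1 - (bz n + bz s + bz e + bz w)) * (P ^ bz n * Q ^ bz s)) = 
      W n s e w * (f' ^ (1 - (bz n' + bz s' + bz e' + bz w')) * (Q ^ bz n' * P ^ bz s')) *
       (N ^ (1 - bz n - bz e - bz w - bz n') * S ^ (1 - bz s - bz e - bz w - bz s') *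
        E ^ (1 - bz n - bz s - bz e - bz e') * V ^ (1 - bz n - bz s - bz w - bz w'))) :
    (∑ n : Bool, ∑ s : Bool, ∑ e : Bool, ∑ w : Bool, if bz n + bz e = r1 ∧ bz s + bz w = r2 ∧
        bz n + bz w = r3 ∧ bz s + bz e = r4 then W n s e w else 0) = 
    (∑ n : Bool, ∑ s : Bool, ∑ e : Bool, ∑ w : Bool, if bz n + bz e = 1 - r1 ∧ bz s + bz w = 1 - r2 ∧
        bz n + bz w = 1 - r3 ∧ bz s + bz e = 1 - r4 then W' n s e w else 0) := by
  have ht : bz true = 1 := rfl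
  have hff : bz false = 0 := rfl
  rcases h1 with rfl | rfl <;> rcases h2 with rfl | rfl <;> rcases h3 with rfl | rfl <;>
    rcases h4 with rfl | rfl <;> simp only [Fintype.sum_bool, ht, hff] <;> norm_num
  · have a := hr false false false false true true false false
    have b := hr false false false false false false true true
    simp only [ht, hff] at a b
    norm_num at a b
    apply mul_left_cancel₀ (mul_ne_zero hf hf')
    field_simp at a b
    linear_combination W false false false false * hrec - a - b
  · have a := hr false true false false true false false false
    simp only [ht, hff] at a
    norm_num at a
    first | exact a.symm | (field_simp at a; exact a.symm) | (rcases a with h | h; exacts [h.symm, absurd h hP]) | (rcases a with h | h; exacts [h.symm, absurd h hQ])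
  · have a := hr false false false true false false true false
    simp only [ht, hff] at a
    norm_num at a
    first | exact a.symm | (field_simp at a; exact a.symm) | (rcases a with h | h; exacts [h.symm, absurd h hP]) | (rcases a with h | h; exacts [h.symm, absurd h hQ])
  · have a := hr false false true false false false false true
    simp only [ht, hff] at a
    norm_num at a
    first | exact a.symm | (field_simp at a; exact a.symm) | (rcases a with h | h; exacts [h.symm, absurd h hP]) | (rcases a with h | h; exacts [h.symm, absurd h hQ])
  · have a := hr true false false false false true false false
    simp only [ht, hff] at a
    norm_num at a
    first | exact a.symm | (field_simp at a; exact a.symm) | (rcases a with h | h; exacts [h.symm, absurd h hP]) | (rcases a with h | h; exacts [h.symm, absurd h hQ])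
  · have a := hr true true false false false false false false
    have b := hr false false true true false false false false
    simp only [ht, hff] at a b
    norm_num at a b
    apply mul_left_cancel₀ (mul_ne_zero hf hf')
    field_simp at a b
    linear_combination - W' false false false false * hrec - a - b
end

def cn (i₀ j₀ k₀ : ℤ) : ℤ × ℤ → ℤ := fun f => k₀ - |f.1 - i₀| - |f.2 - j₀|

lemma abs_nb (x c : ℤ) : (|x + 1 - c| = |x - c| + 1 ∨ |x + 1 - c| = |x - c| - 1) ∧
    (|x - 1 - c| = |x - c| + 1 ∨ |x - 1 - c| = |x - c| - 1) ∧
    (|x + 1 - c| = |x - c| + 1 ∨ |x - 1 - c| = |x - c| + 1) := by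
  rcases abs_cases (x + 1 - c) with h1 | h1 <;> rcases abs_cases (x - 1 - c) with h2 | h2 <;>
  rcases abs_cases (x - c) with h3 | h3 <;> omega

lemma ind_nonneg (X : Finset Edge) (g : Edge) : 0 ≤ ind X g := by unfold ind; split_ifs <;> simp

lemma ind_zero (X : Finset Edge) (g : Edge) (h : g ∉ X) : ind X g = 0 := by simp [ind, h]

lemma sq_congr {κ κ' : ℤ × ℤ → ℤ} {x x' : Edge → ℤ} {a b : ℤ} (h1 : κ' (a, b) = κ (a, b))
    (h2 : κ' (a + 1, b) = κ (a + 1, b)) (h3 : κ' (a, b + 1) = κ (a, b + 1))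
    (h4 : κ' (a + 1, b + 1) = κ (a + 1, b + 1)) (e1 : x' (Edge.h a b) = x (Edge.h a b))
    (e2 : x' (Edge.v a b) = x (Edge.v a b)) (e3 : x' (Edge.h (a+1) b) = x (Edge.h (a+1) b))
    (e4 : x' (Edge.v a (b+1)) = x (Edge.v a (b+1))) : sq κ' x' a b ↔ sq κ x a b := by
  unfold sq; rw [h1, h2, h3, h4, e1, e2, e3, e4]

/-- the part of validity not concerning the face (i,j) -/
def PY (cone κ : ℤ × ℤ → ℤ) (i j : ℤ) (Y : Finset Edge) : Prop :=
  (∀ a b, ¬ ((a = i ∨ a = i - 1) ∧ (b = j ∨ b = j - 1)) → sq κ (ind Y) a b) ∧ ∀ e ∈ Y, isE cone κ e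

lemma mem_Xz {Y : Finset Edge} {i j : ℤ} {n s e w : Bool} {g : Edge} (hg : ¬ isF i j g) :
    g ∈ Xz Y i j n s e w ↔ g ∈ Y := by
  simp only [isF, not_or] at hg
  obtain ⟨g1, g2, g3, g4⟩ := hg
  cases n <;> cases s <;> cases e <;> cases w <;> simp [Xz, g1, g2, g3, g4]

lemma isE_F {cone κ : ℤ × ℤ → ℤ} {i j : ℤ} (h : κ (i, j) < cone (i, j)) (e : Edge) (he : isF i j e) :
    isE cone κ e := by
  rcases he with rfl | rfl | rfl | rfl <;> simp [isE, h]

lemma isE_other {cone κ κ' : ℤ × ℤ → ℤ} {i j m : ℤ} (H : Flip κ κ' i j m) (e : Edge)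
    (he : ¬ isF i j e) : isE cone κ' e ↔ isE cone κ e := by
  rcases e with ⟨a, b⟩ | ⟨a, b⟩ | ⟨a, b⟩
  · simp [isF] at he
    simp only [isE]
    rw [H.o (a, b) (by simp; omega), H.o (a, b+1) (by simp; omega)]
  · simp [isF] at he
    simp only [isE]
    rw [H.o (a, b) (by simp; omega), H.o (a+1, b) (by simp; omega)]
  · rfl

lemma val_iff {cone κ κ' : ℤ × ℤ → ℤ} {i j m : ℤ} (H : Flip κ κ' i j m) (Y : Finset Edge)
    (hY : ∀ e ∈ Y, ¬ isF i j e) (n s e w : Bool) {κ₁ : ℤ × ℤ → ℤ} (h₁ : κ₁ = κ ∨ κ₁ = κ')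
    (hF : PY cone κ i j Y → sq κ₁ (ind (Xz Y i j n s e w)) i j →
      sq κ₁ (ind (Xz Y i j n s e w)) (i-1) (j-1) → sq κ₁ (ind (Xz Y i j n s e w)) (i-1) j →
      sq κ₁ (ind (Xz Y i j n s e w)) i (j-1) → ∀ g ∈ Xz Y i j n s e w, isF i j g → isE cone κ₁ g) :
    Val cone κ₁ (Xz Y i j n s e w) ↔ PY cone κ i j Y ∧ sq κ₁ (ind (Xz Y i j n s e w)) i j ∧
      sq κ₁ (ind (Xz Y i j n s e w)) (i-1) (j-1) ∧ sq κ₁ (ind (Xz Y i j n s e w)) (i-1) j ∧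
      sq κ₁ (ind (Xz Y i j n s e w)) i (j-1) := by
  have ho : ∀ g, g ≠ (i, j) → κ₁ g = κ g := by
    rcases h₁ with rfl | rfl
    · simp
    · exact H.o
  have hE : ∀ g, ¬ isF i j g → (isE cone κ₁ g ↔ isE cone κ g) := by
    rcases h₁ with rfl | rfl
    · simp
    · exact isE_other H
  have X := (ext_Xz Y i j hY n s e w).ho
  have hsq : ∀ a b, ¬ ((a = i ∨ a = i - 1) ∧ (b = j ∨ b = j - 1)) →
      (sq κ₁ (ind (Xz Y i j n s e w)) a b ↔ sq κ (ind Y) a b) := by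
    intro a b hab
    apply sq_congr
    · exact ho _ (by simp; omega)
    · exact ho _ (by simp; omega)
    · exact ho _ (by simp; omega)
    · exact ho _ (by simp; omega)
    · exact X _ (by simp [isF]; omega)
    · exact X _ (by simp [isF]; omega)
    · exact X _ (by simp [isF]; omega)
    · exact X _ (by simp [isF]; omega)
  constructor
  · rintro ⟨h1, h2⟩
    refine ⟨⟨fun a b hab => (hsq a b hab).1 (h1 a b), fun g hg => ?_⟩, h1 _ _, h1 _ _, h1 _ _, h1 _ _⟩
    exact (hE g (hY g hg)).1 (h2 g ((mem_Xz (hY g hg)).2 hg))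
  · rintro ⟨hP, h1, h2, h3, h4⟩
    refine ⟨fun a b => ?_, fun g hg => ?_⟩
    · by_cases hab : (a = i ∨ a = i - 1) ∧ (b = j ∨ b = j - 1)
      · obtain ⟨rfl | rfl, rfl | rfl⟩ := hab <;> assumption
      · exact (hsq a b hab).2 (hP.1 a b hab)
    · by_cases hgF : isF i j g
      · exact hF hP h1 h2 h3 h4 g hg hgF
      · exact (hE g hgF).2 (hP.2 g ((mem_Xz hgF).1 hg))

set_option maxHeartbeats 1000000 in
lemma isE_after {i₀ j₀ k₀ : ℤ} {κ κ' : ℤ × ℤ → ℤ} {i j m : ℤ} (H : Flip κ κ' i j m) (Y : Finset Edge)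
    (hY : ∀ e ∈ Y, ¬ isF i j e) (n s e w : Bool) (hc : ∀ g, κ' g ≤ cn i₀ j₀ k₀ g)
    (hP : PY (cn i₀ j₀ k₀) κ i j Y) (h1 : sq κ' (ind (Xz Y i j n s e w)) i j)
    (h2 : sq κ' (ind (Xz Y i j n s e w)) (i-1) (j-1)) (h3 : sq κ' (ind (Xz Y i j n s e w)) (i-1) j)
    (h4 : sq κ' (ind (Xz Y i j n s e w)) i (j-1)) :
    ∀ g ∈ Xz Y i j n s e w, isF i j g → isE (cn i₀ j₀ k₀) κ' g := by
  obtain ⟨f1, f2, f3, f4, f5, f6, f7, f8⟩ := H.facts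
  have X := ext_Xz Y i j hY n s e w
  have hz : ∀ g, ¬ isF i j g → ¬ isE (cn i₀ j₀ k₀) κ g → ind (Xz Y i j n s e w) g = 0 := by
    intro g hg hg'
    rw [X.ho g hg]
    exact ind_zero _ _ (fun h => hg' (hP.2 g h))
  have nn := ind_nonneg (Xz Y i j n s e w)
  by_cases hcf : κ' (i, j) < cn i₀ j₀ k₀ (i, j)
  · intro g _ hg; exact isE_F hcf g hg
  have q0 := hc (i, j)
  have q1 := hc (i, j+1)
  have q2 := hc (i, j-1)
  have q3 := hc (i+1, j)
  have q4 := hc (i-1, j)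
  have q5 := hc (i+1, j+1)
  have q6 := hc (i-1, j+1)
  have q7 := hc (i-1, j-1)
  have q8 := hc (i+1, j-1)
  have g5 := H.ne
  have g6 := H.nw
  have g7 := H.sw
  have g8 := H.se
  have c1 := H.c1
  have cN := H.n
  have cS := H.s
  have cE := H.e
  have cW := H.w
  have NE : |i + 1 - i₀| = |i - i₀| + 1 → |j + 1 - j₀| = |j - j₀| + 1 →
      ind (Xz Y i j n s e w) (Edge.h i j) = 0 ∧ ind (Xz Y i j n s e w) (Edge.v i j) = 0 := by
    intro A B
    clear g6 q6 g7 q7 g8 q8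
    simp only [cn] at q0 q1 q2 q3 q4 q5 hcf
    have z1 := hz (Edge.h (i+1) j) (by simp [isF]) (by simp only [isE, cn]; omega)
    have z2 := hz (Edge.v i (j+1)) (by simp [isF]) (by simp only [isE, cn]; omega)
    rw [sq, if_pos (by omega)] at h1
    have := nn (Edge.h i j)
    have := nn (Edge.v i j)
    omega
  have NW : |i - 1 - i₀| = |i - i₀| + 1 → |j + 1 - j₀| = |j - j₀| + 1 →
      ind (Xz Y i j n s e w) (Edge.h i j) = 0 ∧ ind (Xz Y i j n s e w) (Edge.v (i-1) j) = 0 := by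
    intro A B
    clear g5 q5 g7 q7 g8 q8
    simp only [cn] at q0 q1 q2 q3 q4 q6 hcf
    have z1 := hz (Edge.h (i-1) j) (by simp [isF]) (by simp only [isE, cn]; omega)
    have z2 := hz (Edge.v (i-1) (j+1)) (by simp [isF]) (by simp only [isE, cn, sub_add_cancel]; omega)
    rw [sq] at h3
    simp only [sub_add_cancel] at h3
    rw [if_neg (by omega), if_pos (by omega)] at h3
    have := nn (Edge.h i j)
    have := nn (Edge.v (i-1) j)
    omega
  have SW : |i - 1 - i₀| = |i - i₀| + 1 → |j - 1 - j₀| = |j - j₀| + 1 →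
      ind (Xz Y i j n s e w) (Edge.h i (j-1)) = 0 ∧ ind (Xz Y i j n s e w) (Edge.v (i-1) j) = 0 := by
    intro A B
    clear g5 q5 g6 q6 g8 q8
    simp only [cn] at q0 q1 q2 q3 q4 q7 hcf
    have z1 := hz (Edge.h (i-1) (j-1)) (by simp [isF]) (by simp only [isE, cn, sub_add_cancel]; omega)
    have z2 := hz (Edge.v (i-1) (j-1)) (by simp [isF]) (by simp only [isE, cn, sub_add_cancel]; omega)
    rw [sq] at h2
    simp only [sub_add_cancel] at h2
    rw [if_pos (by omega)] at h2
    have := nn (Edge.h i (j-1))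
    have := nn (Edge.v (i-1) j)
    omega
  have SE : |i + 1 - i₀| = |i - i₀| + 1 → |j - 1 - j₀| = |j - j₀| + 1 →
      ind (Xz Y i j n s e w) (Edge.h i (j-1)) = 0 ∧ ind (Xz Y i j n s e w) (Edge.v i j) = 0 := by
    intro A B
    clear g5 q5 g6 q6 g7 q7
    simp only [cn] at q0 q1 q2 q3 q4 q8 hcf
    have z1 := hz (Edge.h (i+1) (j-1)) (by simp [isF]) (by simp only [isE, cn, sub_add_cancel]; omega)
    have z2 := hz (Edge.v i (j-1)) (by simp [isF]) (by simp only [isE, cn, sub_add_cancel]; omega)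
    rw [sq] at h4
    simp only [sub_add_cancel] at h4
    rw [if_neg (by omega), if_pos (by omega)] at h4
    have := nn (Edge.h i (j-1))
    have := nn (Edge.v i j)
    omega
  obtain ⟨a1, a2, a3⟩ := abs_nb i i₀
  obtain ⟨b1, b2, b3⟩ := abs_nb j j₀
  have ne0 : ∀ g ∈ Xz Y i j n s e w, ind (Xz Y i j n s e w) g ≠ 0 := by
    intro g hg; simp [ind, hg]
  intro g hg hgF
  have hg0 := ne0 g hg
  by_contra hcon
  clear g5 g6 g7 g8 q5 q6 q7 q8 hP h1 h2 h3 h4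
  simp only [cn] at q0 q1 q2 q3 q4 hcf
  rcases hgF with rfl | rfl | rfl | rfl <;> simp only [isE, cn, sub_add_cancel, not_or, not_lt] at hcon
  · have B : |j + 1 - j₀| = |j - j₀| + 1 := by omega
    rcases a3 with A | A
    · exact hg0 (NE A B).1
    · exact hg0 (NW A B).1
  · have B : |j - 1 - j₀| = |j - j₀| + 1 := by omega
    rcases a3 with A | A
    · exact hg0 (SE A B).1
    · exact hg0 (SW A B).1
  · have A : |i + 1 - i₀| = |i - i₀| + 1 := by omega
    rcases b3 with B | B
    · exact hg0 (NE A B).2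
    · exact hg0 (SE A B).2
  · have A : |i - 1 - i₀| = |i - i₀| + 1 := by omega
    rcases b3 with B | B
    · exact hg0 (NW A B).2
    · exact hg0 (SW A B).2

lemma val_before {i₀ j₀ k₀ : ℤ} {κ κ' : ℤ × ℤ → ℤ} {i j m : ℤ} (H : Flip κ κ' i j m) (Y : Finset Edge)
    (hY : ∀ e ∈ Y, ¬ isF i j e) (n s e w : Bool) (hin : κ (i, j) < cn i₀ j₀ k₀ (i, j)) :
    Val (cn i₀ j₀ k₀) κ (Xz Y i j n s e w) ↔ PY (cn i₀ j₀ k₀) κ i j Y ∧ sq κ (ind (Xz Y i j n s e w)) i j ∧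
      sq κ (ind (Xz Y i j n s e w)) (i-1) (j-1) ∧ sq κ (ind (Xz Y i j n s e w)) (i-1) j ∧
      sq κ (ind (Xz Y i j n s e w)) i (j-1) :=
  val_iff H Y hY n s e w (Or.inl rfl) (fun _ _ _ _ _ g _ hg => isE_F hin g hg)

lemma val_after {i₀ j₀ k₀ : ℤ} {κ κ' : ℤ × ℤ → ℤ} {i j m : ℤ} (H : Flip κ κ' i j m) (Y : Finset Edge)
    (hY : ∀ e ∈ Y, ¬ isF i j e) (n s e w : Bool) (hc : ∀ g, κ' g ≤ cn i₀ j₀ k₀ g) :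
    Val (cn i₀ j₀ k₀) κ' (Xz Y i j n s e w) ↔ PY (cn i₀ j₀ k₀) κ i j Y ∧ sq κ' (ind (Xz Y i j n s e w)) i j ∧
      sq κ' (ind (Xz Y i j n s e w)) (i-1) (j-1) ∧ sq κ' (ind (Xz Y i j n s e w)) (i-1) j ∧
      sq κ' (ind (Xz Y i j n s e w)) i (j-1) :=
  val_iff H Y hY n s e w (Or.inr rfl) (isE_after H Y hY n s e w hc)

lemma sum_sides {K : Type*} [Field K] (E : Finset Edge) (i j : ℤ) (h1 : Edge.h i j ∈ E)
    (h2 : Edge.h i (j-1) ∈ E) (h3 : Edge.v i j ∈ E) (h4 : Edge.v (i-1) j ∈ E) (g : Finset Edge → K) :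
    ∑ X ∈ E.powerset, g X = ∑ Y ∈ (E.filter (fun e => ¬ isF i j e)).powerset,
      ∑ n : Bool, ∑ s : Bool, ∑ e : Bool, ∑ w : Bool, g (Xz Y i j n s e w) := by
  have hE : E = insert (Edge.h i j) (insert (Edge.h i (j-1)) (insert (Edge.v i j)
      (insert (Edge.v (i-1) j) (E.filter (fun e => ¬ isF i j e))))) := by
    ext e
    simp only [Finset.mem_insert]
    rw [Finset.mem_filter]
    constructor
    · intro h; unfold isF; tauto
    · rintro (rfl | rfl | rfl | rfl | h)
      exacts [h1, h2, h3, h4, h.1]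
  have hj : ¬ j = j - 1 := by omega
  have hi : ¬ i = i - 1 := by omega
  conv_lhs => rw [hE]
  rw [Finset.sum_powerset_insert (by simp [isF, hj, hi]), Finset.sum_powerset_insert (by simp [isF, hj, hi]),
    Finset.sum_powerset_insert (by simp [isF, hj, hi]), Finset.sum_powerset_insert (by simp [isF, hj, hi]),
    Finset.sum_powerset_insert (by simp [isF, hj, hi]), Finset.sum_powerset_insert (by simp [isF, hj, hi]),
    Finset.sum_powerset_insert (by simp [isF, hj, hi]), Finset.sum_powerset_insert (by simp [isF, hj, hi])]
  rw [Finset.sum_powerset_insert (by simp [isF, hj, hi]), Finset.sum_powerset_insert (by simp [isF, hj, hi]),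
    Finset.sum_powerset_insert (by simp [isF, hj, hi]), Finset.sum_powerset_insert (by simp [isF, hj, hi]),
    Finset.sum_powerset_insert (by simp [isF, hj, hi]), Finset.sum_powerset_insert (by simp [isF, hj, hi]),
    Finset.sum_powerset_insert (by simp [isF, hj, hi])]
  simp only [← Finset.sum_add_distrib]
  refine Finset.sum_congr rfl fun Y _ => ?_
  simp only [Fintype.sum_bool]
  have e0 : ∀ n s e w, Xz Y i j n s e w = Xz Y i j n s e w := fun _ _ _ _ => rfl
  have key : ∀ n s e w : Bool, Xz Y i j n s e w =
     (if n then insert (Edge.h i j) else id) ((if s then insert (Edge.h i (j-1)) else id)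
      ((if e then insert (Edge.v i j) else id) ((if w then insert (Edge.v (i-1) j) else id) Y))) := by
    intro n s e w
    ext q
    cases n <;> cases s <;> cases e <;> cases w <;> simp [Xz] <;> tauto
  simp only [key]
  simp
  ring

section
variable {K : Type*} [Field K] (C : ℤ → ℤ → K)

def five (i j : ℤ) : Finset (ℤ × ℤ) := {(i, j), (i, j+1), (i, j-1), (i+1, j), (i-1, j)}

lemma prod_five (A : Finset (ℤ × ℤ)) (i j : ℤ) (hA : five i j ⊆ A) (g : ℤ × ℤ → K) :
    ∏ f ∈ A, g f = (∏ f ∈ A \ five i j, g f) *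
      (g (i, j) * (g (i, j+1) * (g (i, j-1) * (g (i+1, j) * g (i-1, j))))) := by
  rw [← Finset.prod_sdiff hA]
  congr 1
  unfold five
  rw [Finset.prod_insert (by simp; omega), Finset.prod_insert (by simp; omega), Finset.prod_insert (by simp),
    Finset.prod_insert (by simp; omega), Finset.prod_singleton]

lemma wt_ratio {κ κ' : ℤ × ℤ → ℤ} {i j m : ℤ} (H : Flip κ κ' i j m) (Y : Finset Edge)
    (hY : ∀ e ∈ Y, ¬ isF i j e) (A : Finset (ℤ × ℤ)) (hA : five i j ⊆ A) (τ τ' : ℤ × ℤ → K)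
    (hτ : ∀ g ∈ A, τ g ≠ 0) (hτ' : ∀ g, g ≠ (i, j) → τ' g = τ g) (hf' : τ' (i, j) ≠ 0)
    (n s e w n' s' e' w' : Bool)
    (k1 : bz n + bz e + (bz n' + bz e') = 1) (k2 : bz s + bz w + (bz s' + bz w') = 1)
    (k3 : bz n + bz w + (bz n' + bz w') = 1) (k4 : bz s + bz e + (bz s' + bz e') = 1)
    (v1 : sq κ (ind (Xz Y i j n s e w)) i j)
    (v2 : sq κ (ind (Xz Y i j n s e w)) (i-1) (j-1)) (v3 : sq κ (ind (Xz Y i j n s e w)) (i-1) j)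
    (v4 : sq κ (ind (Xz Y i j n s e w)) i (j-1))
    (v1' : sq κ' (ind (Xz Y i j n' s' e' w')) i j)
    (v2' : sq κ' (ind (Xz Y i j n' s' e' w')) (i-1) (j-1)) (v3' : sq κ' (ind (Xz Y i j n' s' e' w')) (i-1) j)
    (v4' : sq κ' (ind (Xz Y i j n' s' e' w')) i (j-1)) :
    wt C κ' τ' A (Xz Y i j n' s' e' w') * (τ (i, j) ^ (1 - (bz n + bz s + bz e + bz w)) * 
      (C i (j+m+1) ^ bz n * (C i (j-m))⁻¹ ^ bz s)) = 
    wt C κ τ A (Xz Y i j n s e w) * (τ' (i, j) ^ (1 - (bz n' + bz s' + bz e' + bz w')) * 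
      ((C i (j-m))⁻¹ ^ bz n' * C i (j+m+1) ^ bz s')) *
       (τ (i, j+1) ^ (1 - bz n - bz e - bz w - bz n') * τ (i, j-1) ^ (1 - bz s - bz e - bz w - bz s') *
        τ (i+1, j) ^ (1 - bz n - bz s - bz e - bz e') * τ (i-1, j) ^ (1 - bz n - bz s - bz w - bz w')) := by
  have x := ext_Xz Y i j hY n s e w
  have x' := ext_Xz Y i j hY n' s' e' w'
  obtain ⟨f1, f2, f3, f4, f5, f6, f7, f8⟩ := H.facts
  obtain ⟨o1, o2, o3, o4⟩ := om_vals C H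
  unfold wt
  rw [prod_om_Xz C κ' Y i j hY, prod_om_Xz C κ Y i j hY, o1, o2, o3, o4, prod_five A i j hA, prod_five A i j hA]
  rw [num_center f1 f2 f3 f4 x', num_center H.n H.s H.e H.w x, ex_N H x x' v1 v3 v1' v3' k1 k3,
    ex_S H x x' v4 v2 v4' v2' k4 k2, ex_E H x x' v1 v4 v1' v4' k1 k4, ex_W H x x' v3 v2 v3' v2' k3 k2]
  have hom : ∏ g ∈ Y, om C κ' g = ∏ g ∈ Y, om C κ g :=
    Finset.prod_congr rfl fun g hg => om_other C H g (hY g hg)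
  have hrest : ∏ f ∈ A \ five i j, τ' f ^ ex κ' (ind (Xz Y i j n' s' e' w')) f =
      ∏ f ∈ A \ five i j, τ f ^ ex κ (ind (Xz Y i j n s e w)) f := by
    refine Finset.prod_congr rfl fun g hg => ?_
    obtain ⟨a, b⟩ := g
    simp [five] at hg
    rw [hτ' (a, b) (by simp; omega), ex_other H x x' a b (by omega) (by omega) (by omega) (by omega) (by omega)]
  rw [hom, hrest, hτ' (i, j+1) (by simp), hτ' (i, j-1) (by simp), hτ' (i+1, j) (by simp), hτ' (i-1, j) (by simp)]
  rw [zpow_add₀ (hτ (i, j+1) (hA (by simp [five]))), zpow_add₀ (hτ (i, j-1) (hA (by simp [five]))),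
    zpow_add₀ (hτ (i+1, j) (hA (by simp [five]))), zpow_add₀ (hτ (i-1, j) (hA (by simp [five])))]
  ring

lemma bz_nonneg (b : Bool) : 0 ≤ bz b ∧ bz b ≤ 1 := by cases b <;> simp [bz]

theorem flip_lemma {i₀ j₀ k₀ : ℤ} {κ κ' : ℤ × ℤ → ℤ} {i j m : ℤ} (H : Flip κ κ' i j m)
    (hc : ∀ g, κ' g ≤ cn i₀ j₀ k₀ g) (A : Finset (ℤ × ℤ)) (hA : five i j ⊆ A) (τ τ' : ℤ × ℤ → K)
    (hτ : ∀ g ∈ A, τ g ≠ 0) (hτ' : ∀ g, g ≠ (i, j) → τ' g = τ g) (hf' : τ' (i, j) ≠ 0)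
    (hC : ∀ a b, C a b ≠ 0)
    (hrec : τ (i, j) * τ' (i, j) = C i (j+m+1) * (C i (j-m))⁻¹ * τ (i-1, j) * τ (i+1, j) +
      τ (i, j-1) * τ (i, j+1))
    (E : Finset Edge) (h1 : Edge.h i j ∈ E)
    (h2 : Edge.h i (j-1) ∈ E) (h3 : Edge.v i j ∈ E) (h4 : Edge.v (i-1) j ∈ E) :
    Zf C (cn i₀ j₀ k₀) κ τ A E = Zf C (cn i₀ j₀ k₀) κ' τ' A E := by
  unfold Zf
  rw [sum_sides E i j h1 h2 h3 h4, sum_sides E i j h1 h2 h3 h4]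
  refine Finset.sum_congr rfl fun Y hY => ?_
  replace hY : ∀ e ∈ Y, ¬ isF i j e := fun e he =>
    (Finset.mem_filter.1 (Finset.mem_powerset.1 hY he)).2
  have hin : κ (i, j) < cn i₀ j₀ k₀ (i, j) := by
    have := hc (i, j); have := H.c0; have := H.c1; omega
  simp only [val_before H Y hY _ _ _ _ hin, val_after H Y hY _ _ _ _ hc]
  by_cases hP : PY (cn i₀ j₀ k₀) κ i j Y
  swap
  · simp [hP]
  simp only [hP, true_and]
  obtain ⟨B1, A1, c1, d1⟩ := corNE H (ind Y) (ind_nonneg Y)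
  obtain ⟨B2, A2, c2, d2⟩ := corSW H (ind Y) (ind_nonneg Y)
  obtain ⟨B3, A3, c3, d3⟩ := corNW H (ind Y) (ind_nonneg Y)
  obtain ⟨B4, A4, c4, d4⟩ := corSE H (ind Y) (ind_nonneg Y)
  have X := ext_Xz Y i j hY
  have E1 := fun n s e w => d1 _ _ _ _ _ (X n s e w)
  have E2 := fun n s e w => d2 _ _ _ _ _ (X n s e w)
  have E3 := fun n s e w => d3 _ _ _ _ _ (X n s e w)
  have E4 := fun n s e w => d4 _ _ _ _ _ (X n s e w)
  have bd : ∀ a b : Bool, 0 ≤ bz a + bz b ∧ bz a + bz b ≤ 2 := fun a b => by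
    have := bz_nonneg a; have := bz_nonneg b; omega
  rcases c1 with c1 | ⟨r1, hr1, c1⟩
  · have z1 := fun n s e w => (E1 n s e w).1.trans (iff_false_intro (c1 _ (bd n e).1 (bd n e).2).1)
    have z2 := fun n s e w => (E1 n s e w).2.trans (iff_false_intro (c1 _ (bd n e).1 (bd n e).2).2)
    simp only [z1, z2]; simp
  rcases c2 with c2 | ⟨r2, hr2, c2⟩
  · have z1 := fun n s e w => (E2 n s e w).1.trans (iff_false_intro (c2 _ (bd s w).1 (bd s w).2).1)
    have z2 := fun n s e w => (E2 n s e w).2.trans (iff_false_intro (c2 _ (bd s w).1 (bd s w).2).2)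
    simp only [z1, z2]; simp
  rcases c3 with c3 | ⟨r3, hr3, c3⟩
  · have z1 := fun n s e w => (E3 n s e w).1.trans (iff_false_intro (c3 _ (bd n w).1 (bd n w).2).1)
    have z2 := fun n s e w => (E3 n s e w).2.trans (iff_false_intro (c3 _ (bd n w).1 (bd n w).2).2)
    simp only [z1, z2]; simp
  rcases c4 with c4 | ⟨r4, hr4, c4⟩
  · have z1 := fun n s e w => (E4 n s e w).1.trans (iff_false_intro (c4 _ (bd s e).1 (bd s e).2).1)
    have z2 := fun n s e w => (E4 n s e w).2.trans (iff_false_intro (c4 _ (bd s e).1 (bd s e).2).2)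
    simp only [z1, z2]; simp
  have y1 := fun n s e w => (E1 n s e w).1.trans (c1 _ (bd n e).1 (bd n e).2).1
  have y1' := fun n s e w => (E1 n s e w).2.trans (c1 _ (bd n e).1 (bd n e).2).2
  have y2 := fun n s e w => (E2 n s e w).1.trans (c2 _ (bd s w).1 (bd s w).2).1
  have y2' := fun n s e w => (E2 n s e w).2.trans (c2 _ (bd s w).1 (bd s w).2).2
  have y3 := fun n s e w => (E3 n s e w).1.trans (c3 _ (bd n w).1 (bd n w).2).1
  have y3' := fun n s e w => (E3 n s e w).2.trans (c3 _ (bd n w).1 (bd n w).2).2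
  have y4 := fun n s e w => (E4 n s e w).1.trans (c4 _ (bd s e).1 (bd s e).2).1
  have y4' := fun n s e w => (E4 n s e w).2.trans (c4 _ (bd s e).1 (bd s e).2).2
  simp only [y1, y1', y2, y2', y3, y3', y4, y4']
  have mem : ∀ g ∈ five i j, τ g ≠ 0 := fun g hg => hτ g (hA hg)
  refine sum16 r1 r2 r3 r4 hr1 hr2 hr3 hr4 (fun n s e w => wt C κ τ A (Xz Y i j n s e w))
    (fun n s e w => wt C κ' τ' A (Xz Y i j n s e w)) (τ (i, j)) (τ' (i, j)) (τ (i, j+1)) (τ (i, j-1))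
    (τ (i+1, j)) (τ (i-1, j)) (C i (j+m+1)) (C i (j-m))⁻¹ (mem _ (by simp [five])) hf'
    (mem _ (by simp [five])) (mem _ (by simp [five])) (mem _ (by simp [five])) (mem _ (by simp [five]))
    (hC _ _) (inv_ne_zero (hC _ _)) hrec ?_
  intro n s e w n' s' e' w' q1 q2 q3 q4 q1' q2' q3' q4'
  exact wt_ratio C H Y hY A hA τ τ' hτ hτ' hf' n s e w n' s' e' w' (by omega) (by omega) (by omega) (by omega)
    ((y1 _ _ _ _).2 q1) ((y2 _ _ _ _).2 q2) ((y3 _ _ _ _).2 q3) ((y4 _ _ _ _).2 q4)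
    ((y1' _ _ _ _).2 q1') ((y2' _ _ _ _).2 q2') ((y3' _ _ _ _).2 q3') ((y4' _ _ _ _).2 q4')
end

lemma cv_ne (v : ℤ × ℤ) : cv v ≠ 0 := by
  unfold cv
  intro h
  have := (map_eq_zero_iff _ (IsFractionRing.injective (MvPolynomial Var ℚ) F)).1 h
  exact MvPolynomial.X_ne_zero _ this

def Cp (i a : ℤ) : F := (∏ t ∈ Finset.Ico 0 a, cv (i, t)) * (∏ t ∈ Finset.Ico a 0, cv (i, t))⁻¹

lemma Cp_ne (i a : ℤ) : Cp i a ≠ 0 := 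
  mul_ne_zero (Finset.prod_ne_zero_iff.2 fun _ _ => cv_ne _)
    (inv_ne_zero (Finset.prod_ne_zero_iff.2 fun _ _ => cv_ne _))

lemma Cp_succ (i a : ℤ) : Cp i (a + 1) = Cp i a * cv (i, a) := by
  unfold Cp
  have hc := cv_ne (i, a)
  rcases le_or_gt 0 a with h | h
  · rw [Finset.Ico_eq_empty_of_le h, Finset.Ico_eq_empty_of_le (by omega : (0:ℤ) ≤ a + 1)]
    have : Finset.Ico 0 (a+1) = insert a (Finset.Ico 0 a) := by ext t; simp; omega
    rw [this, Finset.prod_insert (by simp)]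
    simp [mul_comm]
  · rw [Finset.Ico_eq_empty_of_le (by omega : a ≤ 0), Finset.Ico_eq_empty_of_le (by omega : a + 1 ≤ 0)]
    have : Finset.Ico a 0 = insert a (Finset.Ico (a+1) 0) := by ext t; simp; omega
    rw [this, Finset.prod_insert (by simp)]
    field_simp

lemma prod_Icc (i x : ℤ) : ∀ y, x ≤ y + 1 →
    ∏ a ∈ Finset.Icc x y, cv (i, a) = Cp i (y + 1) * (Cp i x)⁻¹ := by
  have key : ∀ y, x ≤ y → ∏ a ∈ Finset.Ico x y, cv (i, a) = Cp i y * (Cp i x)⁻¹ := by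
    intro y hy
    induction y, hy using Int.leInduction with
    | base => simp [Cp_ne]
    | succ n hn ih =>
      have : Finset.Ico x (n+1) = insert n (Finset.Ico x n) := by ext t; simp; omega
      rw [this, Finset.prod_insert (by simp), ih, Cp_succ]; ring
  intro y hy
  rw [← key _ hy]
  rfl

lemma coefJ_eq (i j m : ℤ) (hm : 0 ≤ m) : coefJ cv i j m = Cp i (j + m + 1) * (Cp i (j - m))⁻¹ := by
  unfold coefJ
  rw [← prod_Icc i (j - m) (j + m) (by omega)]
  refine Finset.prod_bij (fun a _ => j + a) ?_ ?_ ?_ ?_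
  · intro a ha; simp at ha ⊢; omega
  · intro a _ b _ h; simpa using h
  · intro b hb; simp at hb; exact ⟨b - j, by simp; omega, by ring⟩
  · intro a _; rfl

lemma coefI_eq (i j m : ℤ) (hm : 0 ≤ m) : coefI cv i j m = 1 := by
  unfold coefI
  rw [Finset.Icc_eq_empty (by omega), Finset.prod_empty]

lemma abs_nb3 (x c : ℤ) : (x = c ∧ |x + 1 - c| = |x - c| + 1 ∧ |x - 1 - c| = |x - c| + 1) ∨
    (x ≠ c ∧ |x + 1 - c| = |x - c| + 1 ∧ |x - 1 - c| = |x - c| - 1) ∨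
    (x ≠ c ∧ |x + 1 - c| = |x - c| - 1 ∧ |x - 1 - c| = |x - c| + 1) := by
  rcases abs_cases (x + 1 - c) with h1 | h1 <;> rcases abs_cases (x - 1 - c) with h2 | h2 <;>
  rcases abs_cases (x - c) with h3 | h3 <;> omega

lemma ex_cone (i₀ j₀ k₀ a b : ℤ) : ex (cn i₀ j₀ k₀) (ind ∅) (a, b) =
    if (a, b) = (i₀, j₀) then 1 else 0 := by
  have z : ∀ e, ind ∅ e = 0 := fun e => by simp [ind]
  simp only [ex, num, qAC, qBD, z, cn, sub_add_cancel, Prod.mk.injEq]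
  rcases abs_nb3 a i₀ with ⟨h1, h2, h3⟩ | ⟨h1, h2, h3⟩ | ⟨h1, h2, h3⟩ <;>
  rcases abs_nb3 b j₀ with ⟨g1, g2, g3⟩ | ⟨g1, g2, g3⟩ | ⟨g1, g2, g3⟩ <;>
  rw [h2, h3, g2, g3] <;> split_ifs <;> omega

lemma sq_cone (i₀ j₀ k₀ a b : ℤ) : sq (cn i₀ j₀ k₀) (ind ∅) a b := by
  have z : ∀ e, ind ∅ e = 0 := fun e => by simp [ind]
  simp only [sq, z, cn]
  rcases (abs_nb a i₀).1 with h | h <;> rcases (abs_nb b j₀).1 with g | g <;> rw [h, g] <;>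
  split_ifs <;> simp only [ne_eq, not_not] at * <;> first | omega | simp

lemma Zf_cone (i₀ j₀ k₀ : ℤ) (τ : ℤ × ℤ → F) (A : Finset (ℤ × ℤ)) (E : Finset Edge)
    (hA : (i₀, j₀) ∈ A) : Zf Cp (cn i₀ j₀ k₀) (cn i₀ j₀ k₀) τ A E = τ (i₀, j₀) := by
  unfold Zf
  rw [Finset.sum_eq_single ∅]
  · have hv : Val (cn i₀ j₀ k₀) (cn i₀ j₀ k₀) ∅ := ⟨fun a b => sq_cone _ _ _ _ _, by simp⟩
    rw [if_pos hv, wt, Finset.prod_empty, mul_one, Finset.prod_eq_single (i₀, j₀)]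
    · rw [ex_cone, if_pos rfl, zpow_one]
    · rintro ⟨a, b⟩ _ h
      rw [ex_cone, if_neg h, zpow_zero]
    · exact fun h => absurd hA h
  · intro X _ hX
    rw [if_neg]
    rintro ⟨_, h⟩
    obtain ⟨e, he⟩ := Finset.nonempty_iff_ne_empty.2 hX
    have := h e he
    rcases e with ⟨a, b⟩ | ⟨a, b⟩ | ⟨a, b⟩ <;> simp [isE] at this
  · simp

def St (κ : ℤ × ℤ → ℤ) : Prop := ∀ i j,
  (κ (i+1, j) = κ (i, j) + 1 ∨ κ (i+1, j) = κ (i, j) - 1) ∧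
  (κ (i, j+1) = κ (i, j) + 1 ∨ κ (i, j+1) = κ (i, j) - 1)

lemma St.left {κ : ℤ × ℤ → ℤ} (h : St κ) (i j : ℤ) :
    κ (i-1, j) = κ (i, j) + 1 ∨ κ (i-1, j) = κ (i, j) - 1 := by
  have := (h (i-1) j).1
  rw [sub_add_cancel] at this; omega

lemma St.down {κ : ℤ × ℤ → ℤ} (h : St κ) (i j : ℤ) :
    κ (i, j-1) = κ (i, j) + 1 ∨ κ (i, j-1) = κ (i, j) - 1 := by
  have := (h i (j-1)).2
  rw [sub_add_cancel] at this; omega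

lemma cn_St (i₀ j₀ k₀ : ℤ) : St (cn i₀ j₀ k₀) := by
  intro a b
  simp only [cn]
  have h := (abs_nb a i₀).1 
  have g := (abs_nb b j₀).1
  omega

lemma min_even (x : ℤ) (hx : Odd x) (y : ℤ) (hy : Odd y) (h : x < y) : x + 2 ≤ y := by
  obtain ⟨a, rfl⟩ := hx; obtain ⟨b, rfl⟩ := hy; omega

lemma flip_exists {i₀ j₀ k₀ : ℤ} (hodd : Odd (i₀ + j₀ + k₀)) {κ : ℤ × ℤ → ℤ} (hst : St κ)
    (hpar : ∀ f : ℤ × ℤ, Odd (f.1 + f.2 + κ f)) (hle : ∀ f, κ f ≤ cn i₀ j₀ k₀ f)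
    (i j : ℤ) (hin : κ (i, j) < cn i₀ j₀ k₀ (i, j))
    (hmin : ∀ g, κ g < cn i₀ j₀ k₀ g → κ (i, j) ≤ κ g) :
    Flip κ (Function.update κ (i, j) (κ (i, j) + 2)) i j (κ (i, j) + 1) ∧
    St (Function.update κ (i, j) (κ (i, j) + 2)) ∧
    (∀ f : ℤ × ℤ, Odd (f.1 + f.2 + Function.update κ (i, j) (κ (i, j) + 2) f)) ∧
    (∀ f, Function.update κ (i, j) (κ (i, j) + 2) f ≤ cn i₀ j₀ k₀ f) := by
  have c := cn_St i₀ j₀ k₀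
  have E : κ (i+1, j) = κ (i, j) + 1 := by
    have := (hst i j).1; have := (c i j).1; have := hmin (i+1, j); omega
  have N : κ (i, j+1) = κ (i, j) + 1 := by
    have := (hst i j).2; have := (c i j).2; have := hmin (i, j+1); omega
  have W : κ (i-1, j) = κ (i, j) + 1 := by
    have := hst.left i j; have := c.left i j; have := hmin (i-1, j); omega
  have S : κ (i, j-1) = κ (i, j) + 1 := by
    have := hst.down i j; have := c.down i j; have := hmin (i, j-1); omega
  have o : ∀ g, g ≠ (i, j) → Function.update κ (i, j) (κ (i, j) + 2) g = κ g := fun g hg =>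
    Function.update_of_ne hg _ _
  have s : Function.update κ (i, j) (κ (i, j) + 2) (i, j) = κ (i, j) + 2 := Function.update_self _ _ _
  refine ⟨⟨by ring, by rw [s]; ring, N, S, E, W, ?_, ?_, ?_, ?_, o⟩, ?_, ?_, ?_⟩
  · have := (hst (i+1) j).2; omega
  · have := (hst (i-1) j).2; omega
  · have := hst.down (i-1) j; omega
  · have := hst.down (i+1) j; omega
  · intro a b
    by_cases h0 : (a, b) = (i, j)
    · obtain ⟨rfl, rfl⟩ := Prod.mk.inj h0
      rw [s, o _ (by simp), o _ (by simp)]; omega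
    · rw [o _ h0]
      refine ⟨?_, ?_⟩
      · by_cases h1 : (a + 1, b) = (i, j)
        · rw [h1, s]
          obtain ⟨rfl, rfl⟩ := Prod.mk.inj h1
          rw [add_sub_cancel_right] at W; omega
        · rw [o _ h1]; exact (hst a b).1
      · by_cases h1 : (a, b + 1) = (i, j)
        · rw [h1, s]
          obtain ⟨rfl, rfl⟩ := Prod.mk.inj h1
          rw [add_sub_cancel_right] at S; omega
        · rw [o _ h1]; exact (hst a b).2
  · intro f
    by_cases h : f = (i, j)
    · subst h; rw [s]; have := hpar (i, j); rw [← add_assoc]; exact this.add_even (by decide)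
    · rw [o _ h]; exact hpar f
  · intro f
    by_cases h : f = (i, j)
    · subst h; rw [s]
      have h1 := hpar (i, j)
      have h2 : Odd (i + j + cn i₀ j₀ k₀ (i, j)) := by
        simp only [cn]
        obtain ⟨q, hq⟩ := hodd
        rcases abs_cases (i - i₀) with ⟨h3, _⟩ | ⟨h3, _⟩ <;> rcases abs_cases (j - j₀) with ⟨h4, _⟩ | ⟨h4, _⟩ <;>
        rw [h3, h4]
        · exact ⟨q, by omega⟩
        · exact ⟨q + j - j₀, by omega⟩
        · exact ⟨q + i - i₀, by omega⟩
        · exact ⟨q + i - i₀ + j - j₀, by omega⟩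
      have := min_even _ h1 _ h2 (by simpa using hin)
      simp at this; omega
    · rw [o _ h]; exact hle f

theorem Zf_eq (i₀ j₀ k₀ : ℤ) (k κ₀ : ℤ × ℤ → ℤ) (hodd : Odd (i₀ + j₀ + k₀))
    (hk : ∀ f, -1 ≤ k f) (T : ℤ → ℤ → ℤ → F)
    (hTne : ∀ i j m : ℤ, k (i, j) ≤ m → Odd (i + j + m) → T i j m ≠ 0)
    (hTrec : ∀ i j m : ℤ, k (i, j) < m → Even (i + j + m) →
        T i j (m - 1) * T i j (m + 1) =
          coefJ cv i j m * T (i - 1) j m * T (i + 1) j m +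
          coefI cv i j m * T i (j - 1) m * T i (j + 1) m)
    (A : Finset (ℤ × ℤ)) (E : Finset Edge) (hA0 : (i₀, j₀) ∈ A)
    (hA : ∀ i j, κ₀ (i, j) < cn i₀ j₀ k₀ (i, j) → five i j ⊆ A)
    (hAk : ∀ f ∈ A, k f ≤ κ₀ f)
    (hE : ∀ i j, κ₀ (i, j) < cn i₀ j₀ k₀ (i, j) → Edge.h i j ∈ E ∧ Edge.h i (j-1) ∈ E ∧
      Edge.v i j ∈ E ∧ Edge.v (i-1) j ∈ E) :
    ∀ (n : ℕ) (κ : ℤ × ℤ → ℤ), St κ → (∀ f : ℤ × ℤ, Odd (f.1 + f.2 + κ f)) →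
      (∀ f, κ f ≤ cn i₀ j₀ k₀ f) → (∀ f, κ₀ f ≤ κ f) →
      ∑ f ∈ A, (cn i₀ j₀ k₀ f - κ f) ≤ n →
      Zf Cp (cn i₀ j₀ k₀) κ (fun f => T f.1 f.2 (κ f)) A E = T i₀ j₀ k₀ := by
  have base : ∀ κ : ℤ × ℤ → ℤ, (∀ f, κ f ≤ cn i₀ j₀ k₀ f) → (¬ ∃ f, κ f < cn i₀ j₀ k₀ f) →
      Zf Cp (cn i₀ j₀ k₀) κ (fun f => T f.1 f.2 (κ f)) A E = T i₀ j₀ k₀ := by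
    intro κ hle hex
    have : κ = cn i₀ j₀ k₀ := by
      funext f
      have := hle f
      have : ¬ κ f < cn i₀ j₀ k₀ f := fun h => hex ⟨f, h⟩
      omega
    subst this
    rw [Zf_cone _ _ _ _ _ _ hA0]
    simp [cn]
  have inA : ∀ κ : ℤ × ℤ → ℤ, (∀ f, κ₀ f ≤ κ f) → ∀ f, κ f < cn i₀ j₀ k₀ f → f ∈ A := by
    intro κ hge f hf
    obtain ⟨i, j⟩ := f
    exact hA i j (lt_of_le_of_lt (hge _) hf) (by simp [five])
  intro n
  induction n with
  | zero =>
    intro κ hst hpar hle hge hsum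
    apply base κ hle
    rintro ⟨f, hf⟩
    have := Finset.sum_pos' (s := A) (f := fun f => cn i₀ j₀ k₀ f - κ f)
      (fun f _ => by have := hle f; simp; omega) ⟨f, inA κ hge f hf, by simp; omega⟩
    simp only [Nat.cast_zero] at hsum
    omega
  | succ n ih =>
    intro κ hst hpar hle hge hsum
    by_cases hex : ∃ f, κ f < cn i₀ j₀ k₀ f
    swap
    · exact base κ hle hex
    obtain ⟨f₁, hf₁⟩ := hex
    obtain ⟨⟨i, j⟩, hf, hfmin⟩ := Finset.exists_min_image (A.filter (fun f => κ f < cn i₀ j₀ k₀ f)) κ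
      ⟨f₁, Finset.mem_filter.2 ⟨inA κ hge f₁ hf₁, hf₁⟩⟩
    have hin := (Finset.mem_filter.1 hf).2
    have hmin : ∀ g, κ g < cn i₀ j₀ k₀ g → κ (i, j) ≤ κ g := fun g hg =>
      hfmin g (Finset.mem_filter.2 ⟨inA κ hge g hg, hg⟩)
    obtain ⟨H, hst', hpar', hle'⟩ := flip_exists hodd hst hpar hle i j hin hmin
    set κ' := Function.update κ (i, j) (κ (i, j) + 2) with hκ'
    have hself : κ' (i, j) = κ (i, j) + 2 := by simp [hκ']
    have hκκ' : ∀ f, κ f ≤ κ' f := by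
      intro f
      by_cases h : f = (i, j)
      · rw [h, hself]; omega
      · rw [H.o f h]
    have hin0 := lt_of_le_of_lt (hge (i, j)) hin
    have hA5 := hA i j hin0
    have hkA : ∀ g ∈ A, k g ≤ κ g := fun g hg => (hAk g hg).trans (hge g)
    have hne : ∀ g ∈ A, T g.1 g.2 (κ g) ≠ 0 := fun g hg => hTne _ _ _ (hkA g hg) (hpar g)
    have hfA : (i, j) ∈ A := hA5 (by simp [five])
    have hkf := hkA _ hfA
    obtain ⟨e1, e2, e3, e4⟩ := hE i j hin0
    rw [flip_lemma Cp H hle' A hA5 (fun f => T f.1 f.2 (κ f)) (fun f => T f.1 f.2 (κ' f)) hne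
      (fun g hg => by simp only [H.o g hg])
      (hTne _ _ _ (hkf.trans (hκκ' _)) (hpar' _)) Cp_ne ?_ E e1 e2 e3 e4]
    · apply ih κ' hst' hpar' hle' (fun f => (hge f).trans (hκκ' f))
      have : ∑ f ∈ A, (cn i₀ j₀ k₀ f - κ' f) < ∑ f ∈ A, (cn i₀ j₀ k₀ f - κ f) := by
        apply Finset.sum_lt_sum
        · intro f _; have := hκκ' f; omega
        · exact ⟨(i, j), hfA, by rw [hself]; omega⟩
      push_cast at hsum
      omega
    · have hm : 0 ≤ κ (i, j) + 1 := by have := hk (i, j); omega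
      have := hTrec i j (κ (i, j) + 1) (by omega) (by
        have := (hpar (i, j)).add_one
        simpa [add_assoc] using this)
      rw [coefJ_eq _ _ _ hm, coefI_eq _ _ _ hm, one_mul] at this
      simp only [hself, H.n, H.s, H.e, H.w]
      rw [← this]
      congr 2 <;> ring

lemma St_of {k : ℤ × ℤ → ℤ} (h : SteppedSurface k) : St k := by
  intro i j
  have h1 := h (i+1, j) (i, j) (by simp)
  have h2 := h (i, j+1) (i, j) (by simp)
  rcases abs_cases (k (i+1, j) - k (i, j)) with g1 | g1 <;>
  rcases abs_cases (k (i, j+1) - k (i, j)) with g2 | g2 <;> omega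

lemma cn_odd {i₀ j₀ k₀ : ℤ} (hodd : Odd (i₀ + j₀ + k₀)) (f : ℤ × ℤ) :
    Odd (f.1 + f.2 + cn i₀ j₀ k₀ f) := by
  obtain ⟨i, j⟩ := f
  simp only [cn]
  obtain ⟨q, hq⟩ := hodd
  rcases abs_cases (i - i₀) with ⟨h3, _⟩ | ⟨h3, _⟩ <;> rcases abs_cases (j - j₀) with ⟨h4, _⟩ | ⟨h4, _⟩ <;>
  rw [h3, h4]
  · exact ⟨q, by omega⟩
  · exact ⟨q + j - j₀, by omega⟩
  · exact ⟨q + i - i₀, by omega⟩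
  · exact ⟨q + i - i₀ + j - j₀, by omega⟩

lemma par_mod {i₀ j₀ k₀ : ℤ} (hodd : Odd (i₀ + j₀ + k₀)) {k : ℤ × ℤ → ℤ}
    (hpar : ∀ f : ℤ × ℤ, Odd (f.1 + f.2 + k f)) (f : ℤ × ℤ) : (cn i₀ j₀ k₀ f - k f) % 2 = 0 := by
  obtain ⟨a, ha⟩ := cn_odd (k₀ := k₀) hodd f
  obtain ⟨b, hb⟩ := hpar f
  omega

lemma kAdj_apply (i₀ j₀ k₀ : ℤ) (k : ℤ × ℤ → ℤ) (f : ℤ × ℤ) :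
    kAdj i₀ j₀ k₀ k f = min (k f) (cn i₀ j₀ k₀ f) := rfl

lemma kAdj_lt {i₀ j₀ k₀ : ℤ} {k : ℤ × ℤ → ℤ} {f : ℤ × ℤ} :
    kAdj i₀ j₀ k₀ k f < cn i₀ j₀ k₀ f ↔ k f < cn i₀ j₀ k₀ f := by
  rw [kAdj_apply]; omega

lemma inner_iff {i₀ j₀ k₀ : ℤ} {k : ℤ × ℤ → ℤ} {f : ℤ × ℤ} :
    f ∈ innerF i₀ j₀ k₀ k ↔ k f < cn i₀ j₀ k₀ f := by
  simp only [innerF, Set.mem_setOf_eq, cn]; omega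

/-- numerical data of the situation -/
structure Sit (i₀ j₀ k₀ : ℤ) (k : ℤ × ℤ → ℤ) : Prop where
  odd : Odd (i₀ + j₀ + k₀)
  st : St k
  par : ∀ f : ℤ × ℤ, Odd (f.1 + f.2 + k f)
  k0 : k (i₀, j₀) ≤ k₀
  ge : ∀ f, -1 ≤ k f

lemma Sit.mod {i₀ j₀ k₀ : ℤ} {k : ℤ × ℤ → ℤ} (S : Sit i₀ j₀ k₀ k) (f : ℤ × ℤ) :
    (cn i₀ j₀ k₀ f - k f) % 2 = 0 := par_mod S.odd S.par f

lemma kAdj_St {i₀ j₀ k₀ : ℤ} {k : ℤ × ℤ → ℤ} (S : Sit i₀ j₀ k₀ k) : St (kAdj i₀ j₀ k₀ k) := by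
  intro i j
  have h := S.st i j
  have c := cn_St i₀ j₀ k₀ i j
  have m1 := S.mod (i, j)
  simp only [kAdj_apply]
  omega

lemma kAdj_par {i₀ j₀ k₀ : ℤ} {k : ℤ × ℤ → ℤ} (S : Sit i₀ j₀ k₀ k) (f : ℤ × ℤ) :
    Odd (f.1 + f.2 + kAdj i₀ j₀ k₀ k f) := by
  rw [kAdj_apply]
  rcases min_choice (k f) (cn i₀ j₀ k₀ f) with h | h <;> rw [h]
  · exact S.par f
  · exact cn_odd S.odd f

lemma lip {k : ℤ × ℤ → ℤ} (h : St k) (i j i' j' : ℤ) : k (i, j) - |i' - i| - |j' - j| ≤ k (i', j') := by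
  have h1 : ∀ (n : ℕ) (i j : ℤ), k (i, j) - n ≤ k (i + n, j) ∧ k (i, j) - n ≤ k (i - n, j) := by
    intro n
    induction n with
    | zero => intro i j; simp
    | succ n ih =>
      intro i j
      have a := (h (i + n) j).1
      have b := h.left (i - n) j
      have := ih i j
      push_cast
      rw [← add_assoc, ← sub_sub i]
      omega
  have h2 : ∀ (n : ℕ) (i j : ℤ), k (i, j) - n ≤ k (i, j + n) ∧ k (i, j) - n ≤ k (i, j - n) := by
    intro n
    induction n with
    | zero => intro i j; simp
    | succ n ih =>
      intro i j
      have a := (h i (j + n)).2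
      have b := h.down i (j - n)
      have := ih i j
      push_cast
      rw [← add_assoc, ← sub_sub j]
      omega
  have e1 : k (i, j) - |i' - i| ≤ k (i', j) := by
    rcases abs_cases (i' - i) with ⟨g, g'⟩ | ⟨g, g'⟩
    · have := (h1 (i' - i).toNat i j).1
      rw [Int.toNat_of_nonneg g'] at this
      rw [show i + (i' - i) = i' by ring] at this; omega
    · have := (h1 (-(i' - i)).toNat i j).2
      rw [Int.toNat_of_nonneg (by omega)] at this
      rw [show i - -(i' - i) = i' by ring] at this; omega
  have e2 : k (i', j) - |j' - j| ≤ k (i', j') := by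
    rcases abs_cases (j' - j) with ⟨g, g'⟩ | ⟨g, g'⟩
    · have := (h2 (j' - j).toNat i' j).1
      rw [Int.toNat_of_nonneg g'] at this
      rw [show j + (j' - j) = j' by ring] at this; omega
    · have := (h2 (-(j' - j)).toNat i' j).2
      rw [Int.toNat_of_nonneg (by omega)] at this
      rw [show j - -(j' - j) = j' by ring] at this; omega
  omega

lemma no_inner {i₀ j₀ k₀ : ℤ} {k : ℤ × ℤ → ℤ} (S : Sit i₀ j₀ k₀ k) (h : k₀ = k (i₀, j₀)) (f : ℤ × ℤ) :
    ¬ k f < cn i₀ j₀ k₀ f := by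
  obtain ⟨a, b⟩ := f
  have := lip S.st i₀ j₀ a b
  simp only [cn]; omega

lemma adj_iff (a b c d : ℤ) : |a - c| + |b - d| = 1 ↔
    (a = c ∧ (b = d + 1 ∨ b = d - 1)) ∨ (b = d ∧ (a = c + 1 ∨ a = c - 1)) := by
  rcases abs_cases (a - c) with ⟨g, g'⟩ | ⟨g, g'⟩ <;> rcases abs_cases (b - d) with ⟨h, h'⟩ | ⟨h, h'⟩ <;> omega

lemma allF_le {i₀ j₀ k₀ : ℤ} {k : ℤ × ℤ → ℤ} (S : Sit i₀ j₀ k₀ k) {f : ℤ × ℤ}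
    (hf : f ∈ allF i₀ j₀ k₀ k) : k f ≤ cn i₀ j₀ k₀ f := by
  rcases hf with hf | hf
  · exact (inner_iff.1 hf).le
  · unfold bdryF at hf
    split_ifs at hf with h
    · rw [Set.mem_singleton_iff.1 hf, ← h]; simp [cn]
    · obtain ⟨_, ⟨c, d⟩, hg, hadj⟩ := hf
      obtain ⟨a, b⟩ := f
      rw [inner_iff] at hg
      have m := S.mod (c, d)
      have n := cn_St i₀ j₀ k₀
      rcases (adj_iff _ _ _ _).1 hadj with ⟨h1, h2 | h2⟩ | ⟨h1, h2 | h2⟩ <;> simp only at h1 h2 <;> subst h1 <;> subst h2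
      · have := (S.st a d).2; have := (n a d).2; omega
      · have := S.st.down a d; have := n.down a d; omega
      · have := (S.st c b).1; have := (n c b).1; omega
      · have := S.st.left c b; have := n.left c b; omega

lemma kAdj_eq {i₀ j₀ k₀ : ℤ} {k : ℤ × ℤ → ℤ} (S : Sit i₀ j₀ k₀ k) {f : ℤ × ℤ}
    (hf : f ∈ allF i₀ j₀ k₀ k) : kAdj i₀ j₀ k₀ k f = k f := by
  rw [kAdj_apply]; exact min_eq_left (allF_le S hf)

lemma center_mem {i₀ j₀ k₀ : ℤ} {k : ℤ × ℤ → ℤ} (S : Sit i₀ j₀ k₀ k) : (i₀, j₀) ∈ allF i₀ j₀ k₀ k := by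
  by_cases h : k₀ = k (i₀, j₀)
  · right; unfold bdryF; rw [if_pos h]; rfl
  · left; rw [inner_iff]; simp only [cn, sub_self, abs_zero]; have := S.k0; omega

lemma adj_mem {i₀ j₀ k₀ : ℤ} {k : ℤ × ℤ → ℤ} (S : Sit i₀ j₀ k₀ k) {f g : ℤ × ℤ}
    (hf : k f < cn i₀ j₀ k₀ f) (hg : |g.1 - f.1| + |g.2 - f.2| = 1) : g ∈ allF i₀ j₀ k₀ k := by
  by_cases h : g ∈ innerF i₀ j₀ k₀ k
  · left; exact h
  · right
    unfold bdryF
    rw [if_neg (fun h => no_inner S h f hf)]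
    exact ⟨h, f, inner_iff.2 hf, hg⟩

lemma allF_finite {i₀ j₀ k₀ : ℤ} {k : ℤ × ℤ → ℤ} (S : Sit i₀ j₀ k₀ k) : (allF i₀ j₀ k₀ k).Finite := by
  apply (Set.finite_Icc ((i₀ - k₀ - 1, j₀ - k₀ - 1) : ℤ × ℤ) (i₀ + k₀ + 1, j₀ + k₀ + 1)).subset
  rintro ⟨a, b⟩ hf
  have h1 := allF_le S hf
  have h2 := S.ge (a, b)
  simp only [cn] at h1
  simp only [Set.mem_Icc, Prod.mk_le_mk]
  rcases abs_cases (a - i₀) with ⟨g, g'⟩ | ⟨g, g'⟩ <;> rcases abs_cases (b - j₀) with ⟨h, h'⟩ | ⟨h, h'⟩ <;> omega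

/-- the four corners of the squares -/
lemma isE_mem {i₀ j₀ k₀ : ℤ} {k : ℤ × ℤ → ℤ} (S : Sit i₀ j₀ k₀ k) (i j : ℤ) :
    (isE (cn i₀ j₀ k₀) (kAdj i₀ j₀ k₀ k) (Edge.h i j) → (i, j) ∈ allF i₀ j₀ k₀ k ∧ (i, j+1) ∈ allF i₀ j₀ k₀ k) ∧
    (isE (cn i₀ j₀ k₀) (kAdj i₀ j₀ k₀ k) (Edge.v i j) → (i, j) ∈ allF i₀ j₀ k₀ k ∧ (i+1, j) ∈ allF i₀ j₀ k₀ k) := by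
  simp only [isE, kAdj_lt]
  refine ⟨?_, ?_⟩
  · rintro (h | h)
    · exact ⟨Or.inl (inner_iff.2 h), adj_mem S h (by simp)⟩
    · exact ⟨adj_mem S h (by simp), Or.inl (inner_iff.2 h)⟩
  · rintro (h | h)
    · exact ⟨Or.inl (inner_iff.2 h), adj_mem S h (by simp)⟩
    · exact ⟨adj_mem S h (by simp), Or.inl (inner_iff.2 h)⟩

lemma isE_finite {i₀ j₀ k₀ : ℤ} {k : ℤ × ℤ → ℤ} (S : Sit i₀ j₀ k₀ k) :
    {e | isE (cn i₀ j₀ k₀) (kAdj i₀ j₀ k₀ k) e}.Finite := by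
  apply (((allF_finite S).image (fun f => Edge.h f.1 f.2)).union
    ((allF_finite S).image (fun f => Edge.v f.1 f.2))).subset
  rintro (⟨a, b⟩ | ⟨a, b⟩ | ⟨a, b⟩) he
  · left; exact ⟨(a, b), ((isE_mem S a b).1 he).1, rfl⟩
  · right; exact ⟨(a, b), ((isE_mem S a b).2 he).1, rfl⟩
  · exact absurd he (by simp [isE])

def FL (κA κB κC κD yL yR yB yT yd : ℤ) : Prop :=
  if κA ≠ κC then yL + yB + yd = 1 ∧ yR + yT + yd = 1
  else if κB ≠ κD then yB + yR + yd = 1 ∧ yL + yT + yd = 1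
  else yL + yB + yR + yT = 1

def EGd (kA kB kC kD cA cB cC cD : ℤ) : Prop :=
  (kA ≠ kC ∨ kB ≠ kD) ∧ (if kB ≠ kD then kA < cA ∨ kC < cC else kB < cB ∨ kD < cD)

structure Loc (kA kB kC kD cA cB cC cD : ℤ) : Prop where
  AB : kB = kA + 1 ∨ kB = kA - 1
  AD : kD = kA + 1 ∨ kD = kA - 1
  BC : kC = kB + 1 ∨ kC = kB - 1
  DC : kC = kD + 1 ∨ kC = kD - 1
  cAB : cB = cA + 1 ∨ cB = cA - 1
  cAD : cD = cA + 1 ∨ cD = cA - 1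
  cadd : cA + cC = cB + cD
  mA : (cA - kA) % 2 = 0

lemma Loc.one {kA kB kC kD cA cB cC cD : ℤ} (H : Loc kA kB kC kD cA cB cC cD) :
    (kA < cA ∧ kB ≥ cB ∧ kD ≥ cD → kB = kA + 1 ∧ kD = kA + 1 ∧ min kC cC = kA ∧ kC ≥ cC) ∧
    (kC < cC ∧ kB ≥ cB ∧ kD ≥ cD → kB = kC + 1 ∧ kD = kC + 1 ∧ min kA cA = kC ∧ kA ≥ cA) ∧
    (kB < cB ∧ kA ≥ cA ∧ kC ≥ cC → kA = kB + 1 ∧ kC = kB + 1 ∧ min kD cD = kB ∧ kD ≥ cD) ∧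
    (kD < cD ∧ kA ≥ cA ∧ kC ≥ cC → kA = kD + 1 ∧ kC = kD + 1 ∧ min kB cB = kD ∧ kB ≥ cB) := by
  obtain ⟨h1, h2, h3, h4, h5, h6, h7, h8⟩ := H
  refine ⟨?_, ?_, ?_, ?_⟩ <;> rintro ⟨g1, g2, g3⟩ <;> omega

lemma Loc.two {kA kB kC kD cA cB cC cD : ℤ} (H : Loc kA kB kC kD cA cB cC cD) :
    (kA < cA → kB ≤ cB ∧ kD ≤ cD) ∧ (kC < cC → kB ≤ cB ∧ kD ≤ cD) ∧
    (kB < cB → kA ≤ cA ∧ kC ≤ cC) ∧ (kD < cD → kA ≤ cA ∧ kC ≤ cC) ∧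
    (kA ≥ cA → kB ≥ cB → kC ≥ cC → kD ≥ cD → cA ≠ cC ∨ cB ≠ cD) ∧
    ¬ (kA ≠ kC ∧ kB ≠ kD) := by
  obtain ⟨h1, h2, h3, h4, h5, h6, h7, h8⟩ := H
  refine ⟨?_, ?_, ?_, ?_, ?_, ?_⟩ <;> intros <;> omega

def VGc (kA kB kC kD cA cB cC cD : ℤ) (t : Bool) : Prop :=
  (t = decide (kB ≠ kD) ∧ (kA < cA ∨ kD < cD)) ∨ (t = decide (kA ≠ kC) ∧ (kB < cB ∨ kC < cC)) ∨
  (t = false ∧ (kA < cA ∨ kB < cB)) ∨ (t = (decide (kB ≠ kD) || decide (kA ≠ kC)) ∧ (kD < cD ∨ kC < cC)) ∨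
  ((t = decide (kB ≠ kD) ∨ t = decide (kA ≠ kC)) ∧ EGd kA kB kC kD cA cB cC cD)

lemma loc_prop (PA PB PC PD QA QB RA RB : Prop) [Decidable QA] [Decidable QB] [Decidable RA] [Decidable RB]
    (yL yR yB yT yd : ℤ) (hL : ¬ (PA ∨ PD) → yL = 0) (hR : ¬ (PB ∨ PC) → yR = 0)
    (hB : ¬ (PA ∨ PB) → yB = 0) (hT : ¬ (PD ∨ PC) → yT = 0)
    (hd : ¬ ((¬ QA ∨ ¬ QB) ∧ if ¬ QB then PA ∨ PC else PB ∨ PD) → yd = 0)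
    (f0 : QA ∨ QB) (f1 : QA → QB → PA ∨ PB ∨ PC ∨ PD → RA ∧ RB)
    (f2 : ¬ QA → PB ∨ PD → ¬ RA ∧ RB) (f3 : ¬ QB → PA ∨ PC → RA ∧ ¬ RB)
    (f4 : ¬ QA → ¬ PB → ¬ PD → ¬ (PA ∧ PC) ∧ (PA ∨ PC → RA ∧ RB))
    (f5 : ¬ QB → ¬ PA → ¬ PC → ¬ (PB ∧ PD) ∧ (PB ∨ PD → RA ∧ RB)) :
    (∀ t : Bool, ((t = decide (¬ QB) ∧ (PA ∨ PD)) ∨ (t = decide (¬ QA) ∧ (PB ∨ PC)) ∨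
  (t = false ∧ (PA ∨ PB)) ∨ (t = (decide (¬ QB) || decide (¬ QA)) ∧ (PD ∨ PC)) ∨
  ((t = decide (¬ QB) ∨ t = decide (¬ QA)) ∧ ((¬ QA ∨ ¬ QB) ∧ if ¬ QB then PA ∨ PC else PB ∨ PD))) →
      (if t = decide (¬ QB) then yL else 0) + (if t = decide (¬ QA) then yR else 0) +
      (if t = false then yB else 0) + (if t = (decide (¬ QB) || decide (¬ QA)) then yT else 0) +
      (if t = decide (¬ QB) ∨ t = decide (¬ QA) then yd else 0) = 1) ↔
    (PA ∨ PB ∨ PC ∨ PD → 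
     if ¬ RA then yL + yB + yd = 1 ∧ yR + yT + yd = 1
  else if ¬ RB then yB + yR + yd = 1 ∧ yL + yT + yd = 1
  else yL + yB + yR + yT = 1) := by
  rw [Bool.forall_bool]
  by_cases qA : QA <;> by_cases qB : QB <;> by_cases pA : PA <;> by_cases pB : PB <;>
    by_cases pC : PC <;> by_cases pD : PD <;> 
    simp [qA, qB, pA, pB, pC, pD] at f0 f1 f2 f3 f4 f5 hL hR hB hT hd ⊢ <;>
    simp [*] <;> try omega

lemma local_iff {kA kB kC kD cA cB cC cD : ℤ} (H : Loc kA kB kC kD cA cB cC cD)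
    (yL yR yB yT yd : ℤ) (hL : ¬ (kA < cA ∨ kD < cD) → yL = 0) (hR : ¬ (kB < cB ∨ kC < cC) → yR = 0)
    (hB : ¬ (kA < cA ∨ kB < cB) → yB = 0) (hT : ¬ (kD < cD ∨ kC < cC) → yT = 0)
    (hd : ¬ EGd kA kB kC kD cA cB cC cD → yd = 0) :
    (∀ t : Bool, VGc kA kB kC kD cA cB cC cD t → 
      (if t = decide (kB ≠ kD) then yL else 0) + (if t = decide (kA ≠ kC) then yR else 0) +
      (if t = false then yB else 0) + (if t = (decide (kB ≠ kD) || decide (kA ≠ kC)) then yT else 0) +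
      (if t = decide (kB ≠ kD) ∨ t = decide (kA ≠ kC) then yd else 0) = 1) ↔
    (kA < cA ∨ kB < cB ∨ kC < cC ∨ kD < cD → 
      FL (min kA cA) (min kB cB) (min kC cC) (min kD cD) yL yR yB yT yd) := by
  have P := loc_prop (kA < cA) (kB < cB) (kC < cC) (kD < cD) (kA = kC) (kB = kD) (min kA cA = min kC cC)
    (min kB cB = min kD cD) yL yR yB yT yd hL hR hB hT hd
  obtain ⟨h1, h2, h3, h4, h5, h6, h7, h8⟩ := H
  clear hL hR hB hT hd
  exact P (by clear P; omega) (by clear P; omega) (by clear P; omega) (by clear P; omega) (by clear P; omega) (by clear P; omega)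

/-- indicator of a set -/
def iS (N : Set Edge) (e : Edge) : ℤ := if e ∈ N then 1 else 0

lemma exU_iff (p : Edge → Prop) (S : Finset Edge) (hS : ∀ e, p e → e ∈ S) :
    (∃! e, p e) ↔ ∑ e ∈ S, (if p e then (1:ℤ) else 0) = 1 := by
  rw [Finset.sum_boole]
  norm_cast
  rw [Finset.card_eq_one]
  constructor
  · rintro ⟨e, he, hu⟩
    refine ⟨e, ?_⟩
    ext g
    simp only [Finset.mem_filter, Finset.mem_singleton]
    constructor
    · rintro ⟨_, hg⟩; exact hu g hg
    · rintro rfl; exact ⟨hS _ he, he⟩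
  · rintro ⟨e, he⟩
    have h : ∀ g, p g ↔ g = e := by
      intro g
      rw [← Finset.mem_singleton, ← he, Finset.mem_filter]
      exact ⟨fun h => ⟨hS _ h, h⟩, fun h => h.2⟩
    exact ⟨e, (h e).2 rfl, fun g hg => (h g).1 hg⟩

def sq5 (a b : ℤ) : Finset Edge := {Edge.h a b, Edge.h (a+1) b, Edge.v a b, Edge.v a (b+1), Edge.d a b}

lemma sum_sq5 (a b : ℤ) (w : Edge → ℤ) : ∑ e ∈ sq5 a b, w e =
    w (Edge.h a b) + w (Edge.h (a+1) b) + w (Edge.v a b) + w (Edge.v a (b+1)) + w (Edge.d a b) := by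
  unfold sq5
  rw [Finset.sum_insert, Finset.sum_insert, Finset.sum_insert, Finset.sum_insert, Finset.sum_singleton]
  · ring
  all_goals simp

lemma mem_sq5 {k : ℤ × ℤ → ℤ} {a b : ℤ} {t : Bool} {e : Edge} (h : Edge.mem k ((a, b), t) e) : e ∈ sq5 a b := by
  unfold sq5
  rcases e with ⟨i, j⟩ | ⟨i, j⟩ | ⟨i, j⟩ <;>
  simp only [Edge.mem, Edge.ends, Prod.mk.injEq] at h <;>
  simp only [Finset.mem_insert, Finset.mem_singleton, Edge.h.injEq, Edge.v.injEq, Edge.d.injEq, reduceCtorEq] <;>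
  omega

lemma mem_h (k : ℤ × ℤ → ℤ) (a b : ℤ) (t : Bool) :
    Edge.mem k ((a, b), t) (Edge.h a b) ↔ t = decide (k (a+1, b) ≠ k (a, b+1)) := by
  simp [Edge.mem, Edge.ends, Edge.tAD]
  omega
lemma mem_h1 (k : ℤ × ℤ → ℤ) (a b : ℤ) (t : Bool) :
    Edge.mem k ((a, b), t) (Edge.h (a+1) b) ↔ t = decide (k (a, b) ≠ k (a+1, b+1)) := by
  simp [Edge.mem, Edge.ends, Edge.tBC]
lemma mem_v (k : ℤ × ℤ → ℤ) (a b : ℤ) (t : Bool) :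
    Edge.mem k ((a, b), t) (Edge.v a b) ↔ t = false := by
  simp [Edge.mem, Edge.ends]
  omega
lemma mem_v1 (k : ℤ × ℤ → ℤ) (a b : ℤ) (t : Bool) :
    Edge.mem k ((a, b), t) (Edge.v a (b+1)) ↔ 
      t = (decide (k (a+1, b) ≠ k (a, b+1)) || decide (k (a, b) ≠ k (a+1, b+1))) := by
  simp [Edge.mem, Edge.ends, Edge.tBC, Edge.tAD]
lemma mem_d (k : ℤ × ℤ → ℤ) (a b : ℤ) (t : Bool) :
    Edge.mem k ((a, b), t) (Edge.d a b) ↔ 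
      t = decide (k (a+1, b) ≠ k (a, b+1)) ∨ t = decide (k (a, b) ≠ k (a+1, b+1)) := by
  simp [Edge.mem, Edge.ends, Edge.tBC, Edge.tAD]

lemma EG_h {i₀ j₀ k₀ : ℤ} {k : ℤ × ℤ → ℤ} (a b : ℤ) : Edge.h a b ∈ EG i₀ j₀ k₀ k ↔
    (k (a, b) < cn i₀ j₀ k₀ (a, b) ∨ k (a, b+1) < cn i₀ j₀ k₀ (a, b+1)) := by
  simp only [EG, Set.mem_ofPred_eq, Edge.valid, Edge.isSide, true_and, inner_iff]
  constructor
  · rintro ⟨f, hf, rfl | rfl⟩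
    · exact Or.inl hf
    · exact Or.inr hf
  · rintro (h | h)
    · exact ⟨_, h, Or.inl rfl⟩
    · exact ⟨_, h, Or.inr rfl⟩
lemma EG_v {i₀ j₀ k₀ : ℤ} {k : ℤ × ℤ → ℤ} (a b : ℤ) : Edge.v a b ∈ EG i₀ j₀ k₀ k ↔
    (k (a, b) < cn i₀ j₀ k₀ (a, b) ∨ k (a+1, b) < cn i₀ j₀ k₀ (a+1, b)) := by
  simp only [EG, Set.mem_ofPred_eq, Edge.valid, Edge.isSide, true_and, inner_iff]
  constructor
  · rintro ⟨f, hf, rfl | rfl⟩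
    · exact Or.inl hf
    · exact Or.inr hf
  · rintro (h | h)
    · exact ⟨_, h, Or.inl rfl⟩
    · exact ⟨_, h, Or.inr rfl⟩
lemma EG_d {i₀ j₀ k₀ : ℤ} {k : ℤ × ℤ → ℤ} (a b : ℤ) : Edge.d a b ∈ EG i₀ j₀ k₀ k ↔
    EGd (k (a, b)) (k (a+1, b)) (k (a+1, b+1)) (k (a, b+1)) 
      (cn i₀ j₀ k₀ (a, b)) (cn i₀ j₀ k₀ (a+1, b)) (cn i₀ j₀ k₀ (a+1, b+1)) (cn i₀ j₀ k₀ (a, b+1)) := by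
  simp only [EG, Set.mem_ofPred_eq, Edge.valid, Edge.isSide, inner_iff, EGd, Edge.tAD, decide_eq_true_eq]
  apply and_congr_right
  intro _
  split_ifs
  · constructor
    · rintro ⟨f, hf, rfl | rfl⟩
      · exact Or.inl hf
      · exact Or.inr hf
    · rintro (h | h)
      · exact ⟨_, h, Or.inl rfl⟩
      · exact ⟨_, h, Or.inr rfl⟩
  · constructor
    · rintro ⟨f, hf, rfl | rfl⟩
      · exact Or.inl hf
      · exact Or.inr hf
    · rintro (h | h)
      · exact ⟨_, h, Or.inl rfl⟩
      · exact ⟨_, h, Or.inr rfl⟩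

lemma VG_iff {i₀ j₀ k₀ : ℤ} {k : ℤ × ℤ → ℤ} (a b : ℤ) (t : Bool) : ((a, b), t) ∈ VG k (EG i₀ j₀ k₀ k) ↔
    VGc (k (a, b)) (k (a+1, b)) (k (a+1, b+1)) (k (a, b+1)) 
      (cn i₀ j₀ k₀ (a, b)) (cn i₀ j₀ k₀ (a+1, b)) (cn i₀ j₀ k₀ (a+1, b+1)) (cn i₀ j₀ k₀ (a, b+1)) t := by
  simp only [VG, Set.mem_ofPred_eq, VGc]
  have md : (Edge.mem k ((a, b), t) (Edge.h a b) ∨ Edge.mem k ((a, b), t) (Edge.h (a + 1) b)) ↔ Edge.mem k ((a, b), t) (Edge.d a b) := by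
    rw [mem_d, mem_h, mem_h1]
  simp only [← EG_h, ← EG_v, ← EG_d, ← mem_v1, ← mem_h1, ← mem_h, ← mem_v k a b, md]
  constructor
  · rintro ⟨e, he, hm⟩
    have := mem_sq5 hm
    simp only [sq5, Finset.mem_insert, Finset.mem_singleton] at this
    rcases this with rfl | rfl | rfl | rfl | rfl <;> tauto
  · rintro (h | h | h | h | h)
    all_goals exact ⟨_, h.2, h.1⟩

lemma Sit.loc {i₀ j₀ k₀ : ℤ} {k : ℤ × ℤ → ℤ} (S : Sit i₀ j₀ k₀ k) (a b : ℤ) :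
    Loc (k (a, b)) (k (a+1, b)) (k (a+1, b+1)) (k (a, b+1)) 
      (cn i₀ j₀ k₀ (a, b)) (cn i₀ j₀ k₀ (a+1, b)) (cn i₀ j₀ k₀ (a+1, b+1)) (cn i₀ j₀ k₀ (a, b+1)) := by
  have h := S.st a b
  have h1 := S.st (a+1) b
  have h2 := S.st a (b+1)
  have c := cn_St i₀ j₀ k₀ a b
  refine ⟨by omega, by omega, by omega, by omega, by omega, by omega, ?_, S.mod _⟩
  simp only [cn]; ring

lemma PM_iff {i₀ j₀ k₀ : ℤ} {k : ℤ × ℤ → ℤ} (S : Sit i₀ j₀ k₀ k) (M : Set Edge) :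
    IsPerfectMatching k (EG i₀ j₀ k₀ k) M ↔ M ⊆ EG i₀ j₀ k₀ k ∧ ∀ a b,
      (k (a, b) < cn i₀ j₀ k₀ (a, b) ∨ k (a+1, b) < cn i₀ j₀ k₀ (a+1, b) ∨
       k (a+1, b+1) < cn i₀ j₀ k₀ (a+1, b+1) ∨ k (a, b+1) < cn i₀ j₀ k₀ (a, b+1) → 
       FL (kAdj i₀ j₀ k₀ k (a, b)) (kAdj i₀ j₀ k₀ k (a+1, b)) (kAdj i₀ j₀ k₀ k (a+1, b+1)) (kAdj i₀ j₀ k₀ k (a, b+1))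
       (iS M (Edge.h a b)) (iS M (Edge.h (a+1) b)) (iS M (Edge.v a b)) (iS M (Edge.v a (b+1))) (iS M (Edge.d a b))) := by
  unfold IsPerfectMatching
  apply and_congr_right
  intro hM
  have key : ∀ e, e ∉ EG i₀ j₀ k₀ k → iS M e = 0 := fun e he => if_neg (fun h => he (hM h))
  have : ∀ a b, _ := fun a b => local_iff (S.loc a b) (iS M (Edge.h a b)) (iS M (Edge.h (a+1) b)) 
    (iS M (Edge.v a b)) (iS M (Edge.v a (b+1))) (iS M (Edge.d a b)) 
    (by rw [← EG_h]; exact key _) (by rw [← EG_h]; exact key _) (by rw [← EG_v]; exact key _) 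
    (by rw [← EG_v]; exact key _) (by rw [← EG_d]; exact key _)
  simp only [kAdj_apply]
  simp only [← this]
  constructor
  · intro h a b t ht
    have h := (exU_iff _ (sq5 a b) (fun e he => mem_sq5 he.2)).1 (h _ ((VG_iff a b t).2 ht))
    rw [sum_sq5] at h
    refine Eq.trans ?_ h
    simp only [mem_h, mem_h1, mem_v, mem_v1, mem_d, iS, and_comm (b := _ = _), and_comm (b := _ ∨ _), ite_and]
  · rintro h ⟨⟨a, b⟩, t⟩ hx
    rw [exU_iff _ (sq5 a b) (fun e he => mem_sq5 he.2), sum_sq5]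
    refine Eq.trans ?_ (h a b t ((VG_iff a b t).1 hx))
    simp only [mem_h, mem_h1, mem_v, mem_v1, mem_d, iS, and_comm (b := _ = _), and_comm (b := _ ∨ _), ite_and]

lemma Loc.dd {kA kB kC kD cA cB cC cD : ℤ} (H : Loc kA kB kC kD cA cB cC cD) :
    (EGd kA kB kC kD cA cB cC cD → (min kA cA = kA ∧ min kB cB = kB ∧ min kC cC = kC ∧ min kD cD = kD) ∧
      (kA < cA ∨ kB < cB ∨ kC < cC ∨ kD < cD)) ∧
    ((kA < cA ∨ kB < cB ∨ kC < cC ∨ kD < cD) → (min kA cA ≠ min kC cC ∨ min kB cB ≠ min kD cD) → 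
      EGd kA kB kC kD cA cB cC cD) ∧
    (¬ (kA < cA ∨ kB < cB ∨ kC < cC ∨ kD < cD) → (min kA cA ≠ min kC cC ∨ min kB cB ≠ min kD cD)) := by
  obtain ⟨h1, h2, h3, h4, h5, h6, h7, h8⟩ := H
  unfold EGd
  refine ⟨?_, ?_, ?_⟩
  · split_ifs <;> omega
  · split_ifs <;> omega
  · omega

/-- some corner of the square is an inner face -/
def Inn (i₀ j₀ k₀ : ℤ) (k : ℤ × ℤ → ℤ) (a b : ℤ) : Prop :=
  k (a, b) < cn i₀ j₀ k₀ (a, b) ∨ k (a+1, b) < cn i₀ j₀ k₀ (a+1, b) ∨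
       k (a+1, b+1) < cn i₀ j₀ k₀ (a+1, b+1) ∨ k (a, b+1) < cn i₀ j₀ k₀ (a, b+1)

/-- the square is split -/
def Spl (κ : ℤ × ℤ → ℤ) (a b : ℤ) : Prop := κ (a, b) ≠ κ (a+1, b+1) ∨ κ (a+1, b) ≠ κ (a, b+1)

def US (κ : ℤ × ℤ → ℤ) (x : Edge → ℤ) (a b : ℤ) : ℤ :=
  if κ (a, b) ≠ κ (a+1, b+1) then x (Edge.h a b) + x (Edge.v a b) else x (Edge.v a b) + x (Edge.h (a+1) b)

section
variable {i₀ j₀ k₀ : ℤ} {k : ℤ × ℤ → ℤ}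

lemma EG_d_Inn (S : Sit i₀ j₀ k₀ k) {a b : ℤ} (h : Edge.d a b ∈ EG i₀ j₀ k₀ k) : Inn i₀ j₀ k₀ k a b :=
  ((S.loc a b).dd.1 ((EG_d a b).1 h)).2

lemma EG_d_Spl (S : Sit i₀ j₀ k₀ k) {a b : ℤ} (h : Edge.d a b ∈ EG i₀ j₀ k₀ k) : Spl (kAdj i₀ j₀ k₀ k) a b := by
  have h' := (EG_d a b).1 h
  obtain ⟨⟨h1, h2, h3, h4⟩, _⟩ := (S.loc a b).dd.1 h'
  unfold Spl
  rw [kAdj_apply, kAdj_apply, kAdj_apply, kAdj_apply, h1, h2, h3, h4]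
  exact h'.1

lemma EG_d_of (S : Sit i₀ j₀ k₀ k) {a b : ℤ} (h : Inn i₀ j₀ k₀ k a b) (h' : Spl (kAdj i₀ j₀ k₀ k) a b) :
    Edge.d a b ∈ EG i₀ j₀ k₀ k :=
  (EG_d a b).2 ((S.loc a b).dd.2.1 h h')

lemma Spl_of (S : Sit i₀ j₀ k₀ k) {a b : ℤ} (h : ¬ Inn i₀ j₀ k₀ k a b) : Spl (kAdj i₀ j₀ k₀ k) a b :=
  (S.loc a b).dd.2.2 h

lemma EG_d_EGbar (S : Sit i₀ j₀ k₀ k) {a b : ℤ} (h : Edge.d a b ∈ EG i₀ j₀ k₀ k) :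
    Edge.d a b ∈ EGbar i₀ j₀ k₀ k := by
  refine ⟨EG_d_Spl S h, ?_⟩
  have h' := (EG_d a b).1 h
  obtain ⟨⟨h1, h2, h3, h4⟩, _⟩ := (S.loc a b).dd.1 h'
  obtain ⟨_, f, hf, hs⟩ := h
  refine ⟨f, Or.inl hf, ?_⟩
  simp only [Edge.isSide, Edge.tAD, kAdj_apply, h1, h2, h3, h4] at hs ⊢
  exact hs

lemma isE_h (a b : ℤ) : isE (cn i₀ j₀ k₀) (kAdj i₀ j₀ k₀ k) (Edge.h a b) ↔ Edge.h a b ∈ EG i₀ j₀ k₀ k := by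
  rw [EG_h]; simp only [isE, kAdj_lt]

lemma isE_v (a b : ℤ) : isE (cn i₀ j₀ k₀) (kAdj i₀ j₀ k₀ k) (Edge.v a b) ↔ Edge.v a b ∈ EG i₀ j₀ k₀ k := by
  rw [EG_v]; simp only [isE, kAdj_lt]

lemma isE_EG {e : Edge} (h : isE (cn i₀ j₀ k₀) (kAdj i₀ j₀ k₀ k) e) : e ∈ EG i₀ j₀ k₀ k := by
  rcases e with ⟨a, b⟩ | ⟨a, b⟩ | ⟨a, b⟩
  · exact (isE_h a b).1 h
  · exact (isE_v a b).1 h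
  · exact absurd h (by simp [isE])

/-- sides of a square with no inner corner are not edges -/
lemma not_Inn {a b : ℤ} (h : ¬ Inn i₀ j₀ k₀ k a b) : 
    Edge.h a b ∉ EG i₀ j₀ k₀ k ∧ Edge.h (a+1) b ∉ EG i₀ j₀ k₀ k ∧ Edge.v a b ∉ EG i₀ j₀ k₀ k ∧
    Edge.v a (b+1) ∉ EG i₀ j₀ k₀ k := by
  unfold Inn at h
  rw [EG_h, EG_h, EG_v, EG_v]; tauto

/-- reconstruct -/
def recN (i₀ j₀ k₀ : ℤ) (k : ℤ × ℤ → ℤ) (X : Finset Edge) : Set Edge :=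
  {e | e ∈ X ∨ ∃ a b, e = Edge.d a b ∧ Edge.d a b ∈ EGbar i₀ j₀ k₀ k ∧ US (kAdj i₀ j₀ k₀ k) (ind X) a b = 0}

def recM (i₀ j₀ k₀ : ℤ) (k : ℤ × ℤ → ℤ) (X : Finset Edge) : Set Edge :=
  {e | e ∈ X ∨ ∃ a b, e = Edge.d a b ∧ Edge.d a b ∈ EG i₀ j₀ k₀ k ∧ US (kAdj i₀ j₀ k₀ k) (ind X) a b = 0}

lemma US_zero {κ : ℤ × ℤ → ℤ} {X : Finset Edge} {a b : ℤ} (hX : ∀ e ∈ X, e ∈ EG i₀ j₀ k₀ k) (h : ¬ Inn i₀ j₀ k₀ k a b) :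
    US κ (ind X) a b = 0 := by
  obtain ⟨h1, h2, h3, h4⟩ := not_Inn h
  have z : ∀ e, e ∉ EG i₀ j₀ k₀ k → ind X e = 0 := fun e he => if_neg (fun g => he (hX e g))
  unfold US
  rw [z _ h1, z _ h2, z _ h3]; simp

lemma recN_eq (S : Sit i₀ j₀ k₀ k) {X : Finset Edge} (hX : ∀ e ∈ X, e ∈ EG i₀ j₀ k₀ k) :
    recN i₀ j₀ k₀ k X = recM i₀ j₀ k₀ k X ∪ diagExt i₀ j₀ k₀ k := by
  ext e
  constructor
  · rintro (h | ⟨a, b, rfl, h, h'⟩)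
    · exact Or.inl (Or.inl h)
    · by_cases g : Edge.d a b ∈ EG i₀ j₀ k₀ k
      · exact Or.inl (Or.inr ⟨a, b, rfl, g, h'⟩)
      · exact Or.inr ⟨h, g, trivial⟩
  · rintro ((h | ⟨a, b, rfl, h, h'⟩) | ⟨h, g, h'⟩)
    · exact Or.inl h
    · exact Or.inr ⟨a, b, rfl, EG_d_EGbar S h, h'⟩
    · rcases e with ⟨a, b⟩ | ⟨a, b⟩ | ⟨a, b⟩
      · exact absurd h' (by simp [Edge.isDiag])
      · exact absurd h' (by simp [Edge.isDiag])
      · exact Or.inr ⟨a, b, rfl, h, US_zero hX (fun g' => g (EG_d_of S g' h.1))⟩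

lemma FL_of_sq {κ : ℤ × ℤ → ℤ} (hκ : St κ) {a b : ℤ} (X : Finset Edge) (hs : sq κ (ind X) a b) {yd : ℤ} 
    (hd : Spl κ a b → yd = 1 - US κ (ind X) a b) :
    FL (κ (a, b)) (κ (a+1, b)) (κ (a+1, b+1)) (κ (a, b+1))
       (ind X (Edge.h a b)) (ind X (Edge.h (a+1) b)) (ind X (Edge.v a b)) (ind X (Edge.v a (b+1))) yd := by
  unfold FL
  unfold sq at hs
  unfold US Spl at hd
  split_ifs at * with h1 h2 <;> first | omega | (simp [h1, h2] at hd; omega) | (simp [h1] at hd; omega)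

lemma sq_of_FL {κ : ℤ × ℤ → ℤ} (hκ : St κ) {a b : ℤ} (X : Finset Edge) {yd : ℤ} (hy : 0 ≤ yd)
    (h : FL (κ (a, b)) (κ (a+1, b)) (κ (a+1, b+1)) (κ (a, b+1))
       (ind X (Edge.h a b)) (ind X (Edge.h (a+1) b)) (ind X (Edge.v a b)) (ind X (Edge.v a (b+1))) yd) :
    sq κ (ind X) a b ∧ (Spl κ a b → yd = 1 - US κ (ind X) a b) := by
  unfold FL at h
  unfold sq US Spl
  split_ifs at * with h1 h2 <;> first | omega | (simp [h1, h2] ; omega) | (simp [h1] ; omega)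

lemma Val_EG {X : Finset Edge} (hV : Val (cn i₀ j₀ k₀) (kAdj i₀ j₀ k₀ k) X) : ∀ e ∈ X, e ∈ EG i₀ j₀ k₀ k :=
  fun e he => isE_EG (hV.2 e he)

lemma Val_nd {cone κ : ℤ × ℤ → ℤ} {X : Finset Edge} (hV : Val cone κ X) (a b : ℤ) : Edge.d a b ∉ X :=
  fun h => absurd (hV.2 _ h) (by simp [isE])

lemma recM_h (X : Finset Edge) (a b : ℤ) : Edge.h a b ∈ recM i₀ j₀ k₀ k X ↔ Edge.h a b ∈ X := by
  simp [recM]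
lemma recM_v (X : Finset Edge) (a b : ℤ) : Edge.v a b ∈ recM i₀ j₀ k₀ k X ↔ Edge.v a b ∈ X := by
  simp [recM]
lemma recN_h (X : Finset Edge) (a b : ℤ) : Edge.h a b ∈ recN i₀ j₀ k₀ k X ↔ Edge.h a b ∈ X := by
  simp [recN]
lemma recN_v (X : Finset Edge) (a b : ℤ) : Edge.v a b ∈ recN i₀ j₀ k₀ k X ↔ Edge.v a b ∈ X := by
  simp [recN]
lemma recN_d {X : Finset Edge} (hV : Val (cn i₀ j₀ k₀) (kAdj i₀ j₀ k₀ k) X) (a b : ℤ) :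
    Edge.d a b ∈ recN i₀ j₀ k₀ k X ↔ Edge.d a b ∈ EGbar i₀ j₀ k₀ k ∧ US (kAdj i₀ j₀ k₀ k) (ind X) a b = 0 := by
  have := Val_nd hV a b
  simp [recN, this]
lemma recM_d {X : Finset Edge} (hV : Val (cn i₀ j₀ k₀) (kAdj i₀ j₀ k₀ k) X) (a b : ℤ) :
    Edge.d a b ∈ recM i₀ j₀ k₀ k X ↔ Edge.d a b ∈ EG i₀ j₀ k₀ k ∧ US (kAdj i₀ j₀ k₀ k) (ind X) a b = 0 := by
  have := Val_nd hV a b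
  simp [recM, this]

/-- `US` is 0 or 1 on split squares -/
lemma US_01 {κ : ℤ × ℤ → ℤ} {X : Finset Edge} {a b : ℤ} (hs : sq κ (ind X) a b) (h : Spl κ a b) :
    US κ (ind X) a b = 0 ∨ US κ (ind X) a b = 1 := by
  have h1 := ind_nonneg X (Edge.h a b)
  have h2 := ind_nonneg X (Edge.h (a+1) b)
  have h3 := ind_nonneg X (Edge.v a b)
  unfold sq at hs
  unfold US
  unfold Spl at h
  split_ifs at * <;> omega

lemma recM_pm (S : Sit i₀ j₀ k₀ k) {X : Finset Edge} (hV : Val (cn i₀ j₀ k₀) (kAdj i₀ j₀ k₀ k) X) :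
    IsPerfectMatching k (EG i₀ j₀ k₀ k) (recM i₀ j₀ k₀ k X) := by
  rw [PM_iff S]
  refine ⟨?_, ?_⟩
  · rintro e (h | ⟨a, b, rfl, h, h'⟩)
    · exact Val_EG hV e h
    · exact h
  · intro a b hi
    have hh : ∀ a b, iS (recM i₀ j₀ k₀ k X) (Edge.h a b) = ind X (Edge.h a b) := by
      intro a b; simp only [iS, ind, recM_h]
    have hv : ∀ a b, iS (recM i₀ j₀ k₀ k X) (Edge.v a b) = ind X (Edge.v a b) := by
      intro a b; simp only [iS, ind, recM_v]
    rw [hh, hh, hv, hv]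
    apply FL_of_sq (kAdj_St S) X (hV.1 a b)
    intro hs
    have := EG_d_of S hi hs
    simp only [iS, recM_d hV, this, true_and]
    rcases US_01 (hV.1 a b) hs with g | g <;> rw [g] <;> simp

lemma recN_mem (S : Sit i₀ j₀ k₀ k) {X : Finset Edge} (hV : Val (cn i₀ j₀ k₀) (kAdj i₀ j₀ k₀ k) X) :
    recN i₀ j₀ k₀ k X ∈ MbarSet i₀ j₀ k₀ k :=
  ⟨_, recM_pm S hV, recN_eq S (Val_EG hV)⟩

lemma recN_inj {X Y : Finset Edge} (hX : Val (cn i₀ j₀ k₀) (kAdj i₀ j₀ k₀ k) X)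
    (hY : Val (cn i₀ j₀ k₀) (kAdj i₀ j₀ k₀ k) Y) (h : recN i₀ j₀ k₀ k X = recN i₀ j₀ k₀ k Y) : X = Y := by
  ext e
  rcases e with ⟨a, b⟩ | ⟨a, b⟩ | ⟨a, b⟩
  · rw [← recN_h (i₀ := i₀) (j₀ := j₀) (k₀ := k₀) (k := k), h, recN_h]
  · rw [← recN_v (i₀ := i₀) (j₀ := j₀) (k₀ := k₀) (k := k), h, recN_v]
  · exact iff_of_false (Val_nd hX a b) (Val_nd hY a b)

lemma recN_surj (S : Sit i₀ j₀ k₀ k) {N : Set Edge} (hN : N ∈ MbarSet i₀ j₀ k₀ k) :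
    ∃ X, Val (cn i₀ j₀ k₀) (kAdj i₀ j₀ k₀ k) X ∧ recN i₀ j₀ k₀ k X = N := by
  obtain ⟨M, hM, rfl⟩ := hN
  rw [PM_iff S] at hM
  obtain ⟨hsub, hM⟩ := hM
  set X : Finset Edge := (isE_finite S).toFinset.filter (· ∈ M) with hXdef
  have hh : ∀ a b, Edge.h a b ∈ X ↔ Edge.h a b ∈ M := by
    intro a b
    simp only [hXdef, Finset.mem_filter, Set.Finite.mem_toFinset, Set.mem_ofPred_eq, isE_h]
    exact ⟨fun h => h.2, fun h => ⟨hsub h, h⟩⟩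
  have hv : ∀ a b, Edge.v a b ∈ X ↔ Edge.v a b ∈ M := by
    intro a b
    simp only [hXdef, Finset.mem_filter, Set.Finite.mem_toFinset, Set.mem_ofPred_eq, isE_v]
    exact ⟨fun h => h.2, fun h => ⟨hsub h, h⟩⟩
  have hXE : ∀ e ∈ X, isE (cn i₀ j₀ k₀) (kAdj i₀ j₀ k₀ k) e := by
    intro e he
    simp only [hXdef, Finset.mem_filter, Set.Finite.mem_toFinset, Set.mem_ofPred_eq] at he
    exact he.1
  have key : ∀ a b, sq (kAdj i₀ j₀ k₀ k) (ind X) a b ∧ 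
      (Inn i₀ j₀ k₀ k a b → Spl (kAdj i₀ j₀ k₀ k) a b → iS M (Edge.d a b) = 1 - US (kAdj i₀ j₀ k₀ k) (ind X) a b) := by
    intro a b
    by_cases hi : Inn i₀ j₀ k₀ k a b
    · have f := hM a b hi
      have hh' : ∀ a b, iS M (Edge.h a b) = ind X (Edge.h a b) := by
        intro a b; simp only [iS, ind, hh]
      have hv' : ∀ a b, iS M (Edge.v a b) = ind X (Edge.v a b) := by
        intro a b; simp only [iS, ind, hv]
      rw [hh', hh', hv', hv'] at f
      have := sq_of_FL (kAdj_St S) X (by unfold iS; split_ifs <;> simp) f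
      exact ⟨this.1, fun _ => this.2⟩
    · refine ⟨?_, fun h => absurd h hi⟩
      obtain ⟨h1, h2, h3, h4⟩ := not_Inn hi
      have z : ∀ e, e ∉ EG i₀ j₀ k₀ k → ind X e = 0 := fun e he => if_neg (fun g => he (isE_EG (hXE e g)))
      have := Spl_of S hi
      unfold sq
      unfold Spl at this
      rw [z _ h1, z _ h2, z _ h3, z _ h4]
      split_ifs <;> simp_all
  have hV : Val (cn i₀ j₀ k₀) (kAdj i₀ j₀ k₀ k) X := ⟨fun a b => (key a b).1, hXE⟩
  refine ⟨X, hV, ?_⟩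
  rw [recN_eq S (Val_EG hV)]
  congr 1
  ext e
  rcases e with ⟨a, b⟩ | ⟨a, b⟩ | ⟨a, b⟩
  · rw [recM_h, hh]
  · rw [recM_v, hv]
  · rw [recM_d hV]
    constructor
    · rintro ⟨h, h'⟩
      have := (key a b).2 (EG_d_Inn S h) (EG_d_Spl S h)
      rw [h'] at this
      by_contra g
      simp [iS, g] at this
    · intro h
      refine ⟨hsub h, ?_⟩
      have := (key a b).2 (EG_d_Inn S (hsub h)) (EG_d_Spl S (hsub h))
      simp only [iS, h, if_true] at this
      omega

lemma sum_rec (S : Sit i₀ j₀ k₀ k) (g : Set Edge → F) :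
    ∑ᶠ N ∈ MbarSet i₀ j₀ k₀ k, g N = 
      ∑ X ∈ (isE_finite S).toFinset.powerset, if Val (cn i₀ j₀ k₀) (kAdj i₀ j₀ k₀ k) X then g (recN i₀ j₀ k₀ k X) else 0 := by
  rw [← Finset.sum_filter, ← finsum_mem_coe_finset]
  symm
  apply finsum_mem_eq_of_bijOn (recN i₀ j₀ k₀ k)
  · refine ⟨?_, ?_, ?_⟩
    · intro X hX
      simp only [Finset.coe_filter, Set.mem_ofPred_eq] at hX
      exact recN_mem S hX.2
    · intro X hX Y hY h
      simp only [Finset.coe_filter, Set.mem_ofPred_eq] at hX hY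
      exact recN_inj hX.2 hY.2 h
    · intro N hN
      obtain ⟨X, hV, h⟩ := recN_surj S hN
      refine ⟨X, ?_, h⟩
      simp only [Finset.coe_filter, Set.mem_ofPred_eq, Finset.mem_powerset]
      refine ⟨?_, hV⟩
      intro e he
      simp only [Set.Finite.mem_toFinset, Set.mem_ofPred_eq]
      exact hV.2 e he
  · intro X _; rfl
end

lemma card_diff (S M : Set Edge) (s : Finset Edge) (h : ∀ e, e ∈ S → e ∈ s) :
    ((S \ M).ncard : ℤ) - ((S ∩ M).ncard : ℤ) = ∑ e ∈ s, if e ∈ S then 1 - 2 * iS M e else 0 := by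
  have h1 : S \ M = ((s.filter (fun e => e ∈ S ∧ e ∉ M) : Finset Edge) : Set Edge) := by
    ext e; simp only [Set.mem_sdiff, Finset.coe_filter, Set.mem_ofPred_eq]
    exact ⟨fun g => ⟨h e g.1, g⟩, fun g => g.2⟩
  have h2 : S ∩ M = ((s.filter (fun e => e ∈ S ∧ e ∈ M) : Finset Edge) : Set Edge) := by
    ext e; simp only [Set.mem_inter_iff, Finset.coe_filter, Set.mem_ofPred_eq]
    exact ⟨fun g => ⟨h e g.1, g⟩, fun g => g.2⟩
  rw [h1, h2, Set.ncard_coe_finset, Set.ncard_coe_finset, Finset.card_filter, Finset.card_filter]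
  push_cast
  rw [← Finset.sum_sub_distrib]
  apply Finset.sum_congr rfl
  intro e _
  unfold iS
  by_cases a : e ∈ S <;> by_cases b : e ∈ M <;> simp [a, b]

def cand (i j : ℤ) : Finset Edge := {Edge.h i j, Edge.h i (j-1), Edge.v i j, Edge.v (i-1) j,
  Edge.d i j, Edge.d (i-1) (j-1), Edge.d (i-1) j, Edge.d i (j-1)}

lemma sum_cand (i j : ℤ) (w : Edge → ℤ) : ∑ e ∈ cand i j, w e =
    w (Edge.h i j) + w (Edge.h i (j-1)) + w (Edge.v i j) + w (Edge.v (i-1) j) + w (Edge.d i j) + w (Edge.d (i-1) (j-1))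
     + w (Edge.d (i-1) j) + w (Edge.d i (j-1)) := by
  unfold cand
  repeat rw [Finset.sum_insert]
  · rw [Finset.sum_singleton]; ring
  all_goals
    simp only [Finset.mem_insert, Finset.mem_singleton, Edge.h.injEq, Edge.v.injEq, Edge.d.injEq, reduceCtorEq, or_false, false_or, not_false_eq_true]
    try omega

lemma mem_cand {κ : ℤ × ℤ → ℤ} {i j : ℤ} {e : Edge} (h : Edge.isSide κ (i, j) e) : e ∈ cand i j := by
  rcases e with ⟨a, b⟩ | ⟨a, b⟩ | ⟨a, b⟩ <;>
  simp only [Edge.isSide, Prod.mk.injEq] at h <;>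
  simp only [cand, Finset.mem_insert, Finset.mem_singleton, Edge.h.injEq, Edge.v.injEq, Edge.d.injEq, reduceCtorEq]
  · omega
  · omega
  · split_ifs at h <;> omega

lemma ceil_half (n : ℤ) : ⌈((n : ℚ)) / 2⌉ = (n + 1) / 2 := by
  rw [Int.ceil_eq_iff]
  have h1 : 2 * ((n + 1) / 2) ≤ n + 1 := by omega
  have h2 : n ≤ 2 * ((n + 1) / 2) := by omega
  have h1' : (2 : ℚ) * (((n + 1) / 2 : ℤ) : ℚ) ≤ n + 1 := by exact_mod_cast h1
  have h2' : (n : ℚ) ≤ 2 * (((n + 1) / 2 : ℤ) : ℚ) := by exact_mod_cast h2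
  constructor <;> linarith

lemma isSide_d (κ : ℤ × ℤ → ℤ) (f : ℤ × ℤ) (a b : ℤ) : Edge.isSide κ f (Edge.d a b) ↔ 
    if κ (a+1, b) ≠ κ (a, b+1) then f = (a, b) ∨ f = (a + 1, b + 1) else f = (a + 1, b) ∨ f = (a, b + 1) := by
  by_cases h : κ (a+1, b) = κ (a, b+1) <;> simp [Edge.isSide, Edge.tAD, h]

section
variable {i₀ j₀ k₀ : ℤ} {k : ℤ × ℤ → ℤ}

lemma St.nosplit {κ : ℤ × ℤ → ℤ} (h : St κ) (a b : ℤ) (h1 : κ (a, b) ≠ κ (a+1, b+1)) : κ (a+1, b) = κ (a, b+1) := by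
  have := h a b; have := h (a+1) b; have := h a (b+1); omega

lemma d_side {X : Finset Edge} (S : Sit i₀ j₀ k₀ k) (hV : Val (cn i₀ j₀ k₀) (kAdj i₀ j₀ k₀ k) X) {f : ℤ × ℤ} 
    (hf : f ∈ allF i₀ j₀ k₀ k) (a b : ℤ) : 
    ((f = (a, b) ∨ f = (a+1, b+1)) → (if Edge.d a b ∈ sides (kAdj i₀ j₀ k₀ k) (EGbar i₀ j₀ k₀ k) f then 
      1 - 2 * iS (recN i₀ j₀ k₀ k X) (Edge.d a b) else 0) = qAC (kAdj i₀ j₀ k₀ k) (ind X) a b) ∧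
    ((f = (a+1, b) ∨ f = (a, b+1)) → (if Edge.d a b ∈ sides (kAdj i₀ j₀ k₀ k) (EGbar i₀ j₀ k₀ k) f then 
      1 - 2 * iS (recN i₀ j₀ k₀ k X) (Edge.d a b) else 0) = qBD (kAdj i₀ j₀ k₀ k) (ind X) a b) := by
  have hst := kAdj_St S
  have ns := hst.nosplit a b
  have key : Edge.d a b ∈ EGbar i₀ j₀ k₀ k → 1 - 2 * iS (recN i₀ j₀ k₀ k X) (Edge.d a b) = 
      2 * US (kAdj i₀ j₀ k₀ k) (ind X) a b - 1 := by
    intro h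
    simp only [iS, recN_d hV, h, true_and]
    rcases US_01 (hV.1 a b) h.1 with g | g <;> rw [g] <;> simp
  constructor
  · intro hab
    by_cases h : kAdj i₀ j₀ k₀ k (a+1, b) ≠ kAdj i₀ j₀ k₀ k (a, b+1)
    · have side : Edge.isSide (kAdj i₀ j₀ k₀ k) f (Edge.d a b) := by
        rw [isSide_d, if_pos h]; exact hab
      have m : Edge.d a b ∈ EGbar i₀ j₀ k₀ k := ⟨Or.inr h, f, hf, side⟩
      rw [if_pos ⟨m, side⟩, key m]
      unfold US qAC
      rw [if_pos h, if_neg (fun g => h (ns g))]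
    · rw [if_neg]
      · unfold qAC; rw [if_neg h]
      · rintro ⟨_, side⟩
        rw [isSide_d, if_neg h] at side
        rcases hab with rfl | rfl <;> simp at side
  · intro hab
    by_cases h : kAdj i₀ j₀ k₀ k (a, b) ≠ kAdj i₀ j₀ k₀ k (a+1, b+1)
    · have side : Edge.isSide (kAdj i₀ j₀ k₀ k) f (Edge.d a b) := by
        rw [isSide_d, if_neg (fun g => g (ns h))]; exact hab
      have m : Edge.d a b ∈ EGbar i₀ j₀ k₀ k := ⟨Or.inl h, f, hf, side⟩
      rw [if_pos ⟨m, side⟩, key m]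
      unfold US qBD
      rw [if_pos h, if_pos h]
    · rw [if_neg]
      · unfold qBD; rw [if_neg h]
      · rintro ⟨⟨v, _⟩, side⟩
        have v' : kAdj i₀ j₀ k₀ k (a+1, b) ≠ kAdj i₀ j₀ k₀ k (a, b+1) := v.resolve_left h
        rw [isSide_d, if_pos v'] at side
        rcases hab with rfl | rfl <;> simp at side

lemma faceExp_eq {X : Finset Edge} (S : Sit i₀ j₀ k₀ k) (hV : Val (cn i₀ j₀ k₀) (kAdj i₀ j₀ k₀ k) X) {f : ℤ × ℤ} 
    (hf : f ∈ allF i₀ j₀ k₀ k) : 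
    faceExp (kAdj i₀ j₀ k₀ k) (EGbar i₀ j₀ k₀ k) (recN i₀ j₀ k₀ k X) f - 1 = ex (kAdj i₀ j₀ k₀ k) (ind X) f := by
  obtain ⟨i, j⟩ := f
  have c := card_diff (sides (kAdj i₀ j₀ k₀ k) (EGbar i₀ j₀ k₀ k) (i, j)) (recN i₀ j₀ k₀ k X) (cand i j)
    (fun e he => mem_cand he.2)
  rw [sum_cand] at c
  have hh : ∀ a b, ((i, j) = (a, b) ∨ (i, j) = (a, b+1)) → 
      (if Edge.h a b ∈ sides (kAdj i₀ j₀ k₀ k) (EGbar i₀ j₀ k₀ k) (i, j) then 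
        1 - 2 * iS (recN i₀ j₀ k₀ k X) (Edge.h a b) else 0) = 1 - 2 * ind X (Edge.h a b) := by
    intro a b hab
    rw [if_pos ⟨⟨trivial, _, hf, hab⟩, hab⟩]
    simp only [iS, ind, recN_h]
  have hv : ∀ a b, ((i, j) = (a, b) ∨ (i, j) = (a+1, b)) → 
      (if Edge.v a b ∈ sides (kAdj i₀ j₀ k₀ k) (EGbar i₀ j₀ k₀ k) (i, j) then 
        1 - 2 * iS (recN i₀ j₀ k₀ k X) (Edge.v a b) else 0) = 1 - 2 * ind X (Edge.v a b) := by
    intro a b hab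
    rw [if_pos ⟨⟨trivial, _, hf, hab⟩, hab⟩]
    simp only [iS, ind, recN_v]
  rw [hh i j (by simp), hh i (j-1) (by simp), hv i j (by simp), hv (i-1) j (by simp),
    (d_side S hV hf i j).1 (by simp), (d_side S hV hf (i-1) (j-1)).1 (by simp),
    (d_side S hV hf (i-1) j).2 (by simp), (d_side S hV hf i (j-1)).2 (by simp)] at c
  have c' : ((sides (kAdj i₀ j₀ k₀ k) (EGbar i₀ j₀ k₀ k) (i, j) \ recN i₀ j₀ k₀ k X).ncard : ℤ) -
    ((sides (kAdj i₀ j₀ k₀ k) (EGbar i₀ j₀ k₀ k) (i, j) ∩ recN i₀ j₀ k₀ k X).ncard : ℤ) =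
     num (kAdj i₀ j₀ k₀ k) (ind X) i j + 2 := by
    rw [c]; unfold num; ring
  unfold faceExp ex
  have : (((sides (kAdj i₀ j₀ k₀ k) (EGbar i₀ j₀ k₀ k) (i, j) \ recN i₀ j₀ k₀ k X).ncard : ℚ) -
    ((sides (kAdj i₀ j₀ k₀ k) (EGbar i₀ j₀ k₀ k) (i, j) ∩ recN i₀ j₀ k₀ k X).ncard : ℚ)) =
     ((num (kAdj i₀ j₀ k₀ k) (ind X) i j + 2 : ℤ) : ℚ) := by
    rw [← c']; push_cast; rfl
  rw [this, ceil_half]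
  simp only
  omega
end

lemma white_iff {κ : ℤ × ℤ → ℤ} (h : St κ) (i j : ℤ) :
    (isWhite κ (Edge.ends κ (Edge.h i j)).1 = true) ↔ κ (i, j) < κ (i, j+1) := by
  have h1 := h (i-1) j
  have h2 := h i j
  rw [show i - 1 + 1 = i by ring] at h1
  simp only [isWhite, Edge.ends, Edge.tBC, show i - 1 + 1 = i by ring]
  by_cases a : κ (i, j) < κ (i - 1, j) <;> by_cases b : κ (i-1, j) = κ (i, j+1) <;> simp [a, b] <;> omega

def isW (κ : ℤ × ℤ → ℤ) (e : Edge) : Prop := ∃ i j, e = Edge.h i j ∧ κ (i, j) < κ (i, j+1)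
def isB (κ : ℤ × ℤ → ℤ) (e : Edge) : Prop := ∃ i j, e = Edge.h i j ∧ ¬ κ (i, j) < κ (i, j+1)

lemma om_split (C : ℤ → ℤ → F) (κ : ℤ × ℤ → ℤ) (X : Finset Edge) : ∏ e ∈ X, om C κ e =
    (∏ e ∈ X.filter (isW κ), om C κ e) * ∏ e ∈ X.filter (isB κ), om C κ e := by
  rw [Finset.prod_filter, Finset.prod_filter, ← Finset.prod_mul_distrib]
  apply Finset.prod_congr rfl
  intro e _
  rcases e with ⟨a, b⟩ | ⟨a, b⟩ | ⟨a, b⟩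
  · by_cases h : κ (a, b) < κ (a, b+1)
    · rw [if_pos ⟨a, b, rfl, h⟩, if_neg, mul_one]
      rintro ⟨a', b', g, g'⟩
      rw [Edge.h.injEq] at g; rw [← g.1, ← g.2] at g'; exact g' h
    · rw [if_neg, if_pos ⟨a, b, rfl, h⟩, one_mul]
      rintro ⟨a', b', g, g'⟩
      rw [Edge.h.injEq] at g; rw [← g.1, ← g.2] at g'; exact h g'
  · simp [om]
  · simp [om]

lemma wp_eq {κ k : ℤ × ℤ → ℤ} (hκ : St κ) (hk : ∀ f, -1 ≤ k f) (N : Set Edge) (X : Finset Edge)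
    (hNX : ∀ i j, Edge.h i j ∈ N ↔ Edge.h i j ∈ X) 
    (hX : ∀ i j, Edge.h i j ∈ X → κ (i, j) = k (i, j) ∧ κ (i, j+1) = k (i, j+1))
    (P : Set ((ℤ × ℤ) × (ℤ × ℤ))) (hP : IsPerfectPairing κ N P) :
    wp k P = ∏ e ∈ X, om Cp κ e := by
  obtain ⟨p1, p2, p3, _⟩ := hP
  have wb : ∀ i j, (isWhite κ (Edge.ends κ (Edge.h i j)).1 = false) ↔ ¬ κ (i, j) < κ (i, j+1) := by
    intro i j; rw [← white_iff hκ]; simp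
  have bw : Set.BijOn (fun q : (ℤ × ℤ) × (ℤ × ℤ) => Edge.h q.2.1 q.2.2) P (X.filter (isW κ) : Finset Edge) := by
    refine ⟨?_, ?_, ?_⟩
    · intro q hq
      obtain ⟨_, _, _, h4⟩ := p1 q hq
      rw [NSet, Set.mem_ofPred_eq, white_iff hκ, hNX] at h4
      simp only [Finset.coe_filter, Set.mem_ofPred_eq]
      exact ⟨h4.1, _, _, rfl, h4.2⟩
    · intro q hq q' hq' h
      obtain ⟨_, _, _, h4⟩ := p1 q hq
      simp only [Edge.h.injEq] at h
      have e : q'.2 = (q.2.1, q.2.2) := Prod.ext h.1.symm h.2.symm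
      exact (p3 _ _ h4).unique ⟨hq, rfl⟩ ⟨hq', e⟩
    · intro e he
      simp only [Finset.coe_filter, Set.mem_ofPred_eq] at he
      obtain ⟨he, i, j, rfl, h⟩ := he
      obtain ⟨q, ⟨hq, hq'⟩, _⟩ := p3 i j ⟨(hNX _ _).2 he, (white_iff hκ i j).2 h⟩
      exact ⟨q, hq, by simp [hq']⟩
  have bb : Set.BijOn (fun q : (ℤ × ℤ) × (ℤ × ℤ) => Edge.h q.1.1 (q.1.2 - 1)) P (X.filter (isB κ) : Finset Edge) := by
    refine ⟨?_, ?_, ?_⟩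
    · intro q hq
      obtain ⟨_, _, h4, _⟩ := p1 q hq
      rw [SSet, Set.mem_ofPred_eq, wb, hNX] at h4
      simp only [Finset.coe_filter, Set.mem_ofPred_eq]
      exact ⟨h4.1, _, _, rfl, h4.2⟩
    · intro q hq q' hq' h
      obtain ⟨_, _, h4, _⟩ := p1 q hq
      simp only [Edge.h.injEq] at h
      have e : q'.1 = (q.1.1, q.1.2) := Prod.ext h.1.symm (by have := h.2; simp only; omega)
      exact (p2 _ _ h4).unique ⟨hq, rfl⟩ ⟨hq', e⟩
    · intro e he
      simp only [Finset.coe_filter, Set.mem_ofPred_eq] at he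
      obtain ⟨he, i, j, rfl, h⟩ := he
      obtain ⟨q, ⟨hq, hq'⟩, _⟩ := p2 i (j+1) (by
        rw [SSet, Set.mem_ofPred_eq, wb, add_sub_cancel_right]
        exact ⟨(hNX _ _).2 he, h⟩)
      exact ⟨q, hq, by simp [hq']⟩
  have fin : P.Finite := bw.finite_iff_finite.2 (Finset.finite_toSet _)
  rw [om_split, ← finprod_mem_coe_finset (f := om Cp κ) (s := X.filter (isW κ)),
    ← finprod_mem_coe_finset (f := om Cp κ) (s := X.filter (isB κ)),
    ← finprod_mem_eq_of_bijOn _ bw (f := fun q => om Cp κ (Edge.h q.2.1 q.2.2)) (fun _ _ => rfl),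
    ← finprod_mem_eq_of_bijOn _ bb (f := fun q => om Cp κ (Edge.h q.1.1 (q.1.2-1))) (fun _ _ => rfl),
    ← finprod_mem_mul_distrib fin]
  unfold wp
  apply finprod_mem_congr rfl
  intro q hq
  obtain ⟨h1, h2, h3, h4⟩ := p1 q hq
  rw [NSet, Set.mem_ofPred_eq, white_iff hκ, hNX] at h4
  rw [SSet, Set.mem_ofPred_eq, wb, hNX] at h3
  have e4 := (hX _ _ h4.1).1
  have e3 := (hX _ _ h3.1).2
  obtain ⟨⟨i, j1⟩, ⟨i', j2⟩⟩ := q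
  simp only at h1 h2 h3 h4 e3 e4 ⊢
  subst h1
  rw [sub_add_cancel] at e3
  simp only [om]
  rw [if_pos h4.2, if_neg h3.2, sub_add_cancel, e3, e4]
  unfold pairWeight
  have k1 := hk (i, j1)
  have k2 := hk (i, j2)
  simp only
  rw [prod_Icc i _ _ (by omega)]
  rw [show j2 + k (i, j2) + 1 + 1 = j2 + k (i, j2) + 2 by ring, show j1 - k (i, j1) - 1 = j1 - 1 - k (i, j1) by ring]

/-- **Perfect-matching solution for the closure** (Theorem `thm:mainclosure`):
`T(i₀,j₀,k₀) = Σ_{M̄ ∈ M̄set} w_p(M̄)·w_f(M̄)`, where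
`M̄set = { M ∪ Diag(E(Ḡ)\E(G)) : M a perfect matching of G }` and all faces of the
closure `Ḡ` are closed. -/
theorem perfect_matching_solution_closure
    (i₀ j₀ k₀ : ℤ) (k : ℤ × ℤ → ℤ)
    (hstep : SteppedSurface k)
    (hodd : Odd (i₀ + j₀ + k₀))
    (hoddk : ∀ f : ℤ × ℤ, Odd (f.1 + f.2 + k f))
    (hk0 : k (i₀, j₀) ≤ k₀)
    (hfund : ∀ f : ℤ × ℤ, fund f ≤ k f)
    (T : ℤ → ℤ → ℤ → F)
    (hT0 : ∀ i j : ℤ, T i j (k (i, j)) = tv (i, j))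
    (hTne : ∀ i j m : ℤ, k (i, j) ≤ m → Odd (i + j + m) → T i j m ≠ 0)
    (hTrec : ∀ i j m : ℤ, k (i, j) < m → Even (i + j + m) →
        T i j (m - 1) * T i j (m + 1) =
          coefJ cv i j m * T (i - 1) j m * T (i + 1) j m +
          coefI cv i j m * T i (j - 1) m * T i (j + 1) m)
    (pr : Set Edge → Set ((ℤ × ℤ) × (ℤ × ℤ)))
    (hpr : ∀ N ∈ MbarSet i₀ j₀ k₀ k, IsPerfectPairing (kAdj i₀ j₀ k₀ k) N (pr N)) :
    T i₀ j₀ k₀ =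
      ∑ᶠ N ∈ MbarSet i₀ j₀ k₀ k,
        wp k (pr N) * wfClosed (kAdj i₀ j₀ k₀ k) (EGbar i₀ j₀ k₀ k) N (allF i₀ j₀ k₀ k) := by
  have S : Sit i₀ j₀ k₀ k := by
    refine ⟨hodd, St_of hstep, hoddk, hk0, ?_⟩
    intro f
    have h := hfund f
    have h' := Int.emod_nonneg (f.1 + f.2) (two_ne_zero (α := ℤ))
    unfold fund at h
    omega
  have hle : ∀ f, kAdj i₀ j₀ k₀ k f ≤ cn i₀ j₀ k₀ f := fun f => min_le_right _ _
  have memA : ∀ f, f ∈ (allF_finite S).toFinset ↔ f ∈ allF i₀ j₀ k₀ k := fun f => Set.Finite.mem_toFinset _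
  have memE : ∀ e, e ∈ (isE_finite S).toFinset ↔ isE (cn i₀ j₀ k₀) (kAdj i₀ j₀ k₀ k) e :=
    fun e => Set.Finite.mem_toFinset _
  have Z := Zf_eq i₀ j₀ k₀ k (kAdj i₀ j₀ k₀ k) hodd S.ge T hTne hTrec (allF_finite S).toFinset
    (isE_finite S).toFinset ((memA _).2 (center_mem S))
    (by
      intro i j h f hf
      rw [kAdj_lt] at h
      rw [memA]
      simp only [five, Finset.mem_insert, Finset.mem_singleton] at hf
      rcases hf with rfl | rfl | rfl | rfl | rfl
      · exact Or.inl (inner_iff.2 h)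
      all_goals exact adj_mem S h (by simp))
    (fun f hf => (kAdj_eq S ((memA f).1 hf)).ge)
    (by
      intro i j h
      refine ⟨(memE _).2 (Or.inl h), (memE _).2 (Or.inr ?_), (memE _).2 (Or.inl h),
        (memE _).2 (Or.inr ?_)⟩
      · rw [sub_add_cancel]; exact h
      · rw [sub_add_cancel]; exact h)
    (∑ f ∈ (allF_finite S).toFinset, (cn i₀ j₀ k₀ f - kAdj i₀ j₀ k₀ k f)).toNat
    (kAdj i₀ j₀ k₀ k) (kAdj_St S) (kAdj_par S) hle (fun f => le_rfl) (Int.self_le_toNat _)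
  rw [← Z, sum_rec S, Zf]
  apply Finset.sum_congr rfl
  intro X _
  split_ifs with hV
  · rw [mul_comm]
    unfold wt
    congr 1
    · unfold wfClosed
      rw [finprod_mem_eq_finite_toFinset_prod _ (allF_finite S)]
      apply Finset.prod_congr rfl
      intro f hf
      rw [memA] at hf
      rw [faceExp_eq S hV hf]
      have h1 : T f.1 f.2 (kAdj i₀ j₀ k₀ k f) = tv f := by
        rw [kAdj_eq S hf]; exact hT0 f.1 f.2
      exact congrArg (fun x => x ^ ex (kAdj i₀ j₀ k₀ k) (ind X) f) h1
    · symm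
      apply wp_eq (kAdj_St S) S.ge _ X (recN_h X) _ _ (hpr _ (recN_mem S hV))
      intro i j h
      have := (isE_mem S i j).1 (hV.2 _ h)
      exact ⟨kAdj_eq S this.1, kAdj_eq S this.2⟩
  · rfl

end OctahedronTSystem
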